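/- arXiv:1205.5913 — 7 statements merged into one kernel-verified Lean document; each statement's English description precedes it below -/
import Mathlib

section
/- Let Γ be a finite bipartite simple graph on n = n₁ + n₂ vertices with nonempty parts V₁ (of size n₁) and V₂ (of size n₂), so that every edge joins a vertex of V₁ to a vertex of V₂. Let δ̄₁ = (1/n₁)·Σ_{u∈V₁} deg(u) and δ̄₂ = (1/n₂)·Σ_{u∈V₂} deg(u) be the average degrees of the two parts, and let λ₁ be the largest eigenvalue of the adjacency matrix A of Γ. Then √(δ̄₁·δ̄₂) ≤ λ₁, and equality holds if and only if Γ is (δ̄₁, δ̄₂)-biregular, i.e., every vertex of V₁ has degree δ̄₁ and every vertex of V₂ has degree δ̄₂. -/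
open Finset

open Matrix in
theorem Matrix.IsHermitian.posSemidef_algebraMap_sub {n : Type*} [Fintype n] [DecidableEq n]
    {A : Matrix n n ℝ} (hA : A.IsHermitian) {r : ℝ} (hr : ∀ μ ∈ spectrum ℝ A, μ ≤ r) :
    (algebraMap ℝ (Matrix n n ℝ) r - A).PosSemidef := by
  rw [posSemidef_iff_isHermitian_and_spectrum_nonneg, ← spectrum.singleton_sub_eq]
  refine ⟨IsHermitian.sub ?_ hA, ?_⟩
  · rw [Algebra.algebraMap_eq_smul_one]
    simp [IsHermitian]
  · rintro _ ⟨_, rfl, μ, hμ, rfl⟩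
    exact sub_nonneg.2 (hr μ hμ)

theorem Matrix.algebraMap_sub_mulVec_apply {n R : Type*} [Fintype n] [DecidableEq n] [CommRing R]
    (A : Matrix n n R) (r : R) (x : n → R) (i : n) :
    ((algebraMap R (Matrix n n R) r - A).mulVec x) i = r * x i - (A.mulVec x) i := by
  simp [Algebra.algebraMap_eq_smul_one, sub_mulVec, smul_mulVec]

namespace SimpleGraph

variable {V : Type*} [Fintype V] (G : SimpleGraph V) [DecidableRel G.Adj]

/-- An eigenvalue of the adjacency matrix has square at most `c` whenever every vertex is
the start of at most `c` walks of length two. -/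
theorem sq_le_of_mem_spectrum_adjMatrix [DecidableEq V] {c r : ℝ}
    (hc : ∀ u, ∑ v ∈ G.neighborFinset u, (G.degree v : ℝ) ≤ c)
    (hr : r ∈ spectrum ℝ (G.adjMatrix ℝ)) : r ^ 2 ≤ c := by
  rw [← Matrix.spectrum_toLin', ← Module.End.hasEigenvalue_iff_mem_spectrum] at hr
  obtain ⟨y, hy⟩ := hr.exists_hasEigenvector
  have hsum (u : V) : r * y u = ∑ v ∈ G.neighborFinset u, y v := by
    simpa [eq_comm] using congrFun hy.apply_eq_smul u
  obtain ⟨i, hi⟩ := Function.ne_iff.1 hy.2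
  obtain ⟨m, -, hm⟩ := exists_max_image univ (fun u => |y u|) ⟨i, mem_univ i⟩
  have hpos : 0 < |y m| := (abs_pos.2 hi).trans_le (hm i (mem_univ i))
  have hwalk (u : V) : |r * y u| ≤ G.degree u * |y m| := by
    rw [hsum]
    refine (abs_sum_le_sum_abs _ _).trans ?_
    refine (sum_le_sum fun v _ => hm v (mem_univ v)).trans ?_
    simp
  refine le_of_mul_le_mul_right ?_ hpos
  calc
    r ^ 2 * |y m| = |r * (r * y m)| := by
      rw [← mul_assoc, abs_mul, ← sq, abs_of_nonneg (sq_nonneg r)]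
    _ = |∑ v ∈ G.neighborFinset m, r * y v| := by rw [hsum, mul_sum]
    _ ≤ ∑ v ∈ G.neighborFinset m, G.degree v * |y m| :=
      (abs_sum_le_sum_abs _ _).trans (sum_le_sum fun v _ => hwalk v)
    _ ≤ c * |y m| := by
      rw [← sum_mul]
      exact mul_le_mul_of_nonneg_right (hc m) hpos.le

variable {G} {s t : Finset V}

theorem IsBipartiteWith.sum_neighborFinset_eq (h : G.IsBipartiteWith (s : Set V) t) {f : V → ℝ}
    {c : ℝ} (hf : ∀ v ∈ t, f v = c) {u : V} (hu : u ∈ s) :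
    ∑ v ∈ G.neighborFinset u, f v = G.degree u * c := by
  rw [sum_congr rfl fun v hv => hf v (h.mem_of_mem_adj hu ((G.mem_neighborFinset u v).1 hv))]
  simp

end SimpleGraph

/-- For a finite bipartite simple graph with nonempty parts `V1`, `V2`,
average part degrees `d1`, `d2` and largest adjacency eigenvalue `lam1`, we have
`√(d1·d2) ≤ lam1`, with equality iff the graph is `(d1, d2)`-biregular. -/
theorem bipartite_sqrt_avg_degrees_le_largest_eigenvalue
    {V : Type*} [Fintype V] [DecidableEq V]
    (G : SimpleGraph V) [DecidableRel G.Adj]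
    (V1 V2 : Finset V) (hV1 : V1.Nonempty) (hV2 : V2.Nonempty)
    (hpart : ∀ v, v ∈ V1 ↔ v ∉ V2)
    (hbip : ∀ u v, G.Adj u v → ((u ∈ V1 ∧ v ∈ V2) ∨ (u ∈ V2 ∧ v ∈ V1)))
    (d1 d2 lam1 : ℝ)
    (hd1 : d1 = (∑ u ∈ V1, (G.degree u : ℝ)) / (V1.card : ℝ))
    (hd2 : d2 = (∑ u ∈ V2, (G.degree u : ℝ)) / (V2.card : ℝ))
    (hmem : lam1 ∈ spectrum ℝ (G.adjMatrix ℝ))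
    (hmax : ∀ μ ∈ spectrum ℝ (G.adjMatrix ℝ), μ ≤ lam1) :
    Real.sqrt (d1 * d2) ≤ lam1 ∧
      (Real.sqrt (d1 * d2) = lam1 ↔
        ((∀ u ∈ V1, (G.degree u : ℝ) = d1) ∧ (∀ u ∈ V2, (G.degree u : ℝ) = d2))) := by
  have h12 : G.IsBipartiteWith (V1 : Set V) V2 :=
    ⟨disjoint_coe.2 (disjoint_left.2 fun v hv => (hpart v).1 hv), fun u v huv => hbip u v huv⟩
  have hcompl : V2 = V1ᶜ := by
    ext v
    simp [hpart]
  have hsplit (f : V → ℝ) : ∑ v, f v = ∑ v ∈ V1, f v + ∑ v ∈ V2, f v := by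
    rw [hcompl, sum_add_sum_compl]
  have hdeg : ∑ u ∈ V2, (G.degree u : ℝ) = ∑ u ∈ V1, (G.degree u : ℝ) := by
    exact_mod_cast (SimpleGraph.isBipartiteWith_sum_degrees_eq h12).symm
  set e := ∑ u ∈ V1, (G.degree u : ℝ) with he
  rw [hdeg] at hd2
  have he0 : 0 ≤ e := sum_nonneg fun u _ => Nat.cast_nonneg _
  have hn1 : (0 : ℝ) < V1.card := by exact_mod_cast hV1.card_pos
  have hn2 : (0 : ℝ) < V2.card := by exact_mod_cast hV2.card_pos
  obtain ⟨a, ha, ha2⟩ : ∃ a : ℝ, 0 < a ∧ a ^ 2 = V2.card :=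
    ⟨√V2.card, Real.sqrt_pos.2 hn2, Real.sq_sqrt hn2.le⟩
  obtain ⟨b, hb, hb2⟩ : ∃ b : ℝ, 0 < b ∧ b ^ 2 = V1.card :=
    ⟨√V1.card, Real.sqrt_pos.2 hn1, Real.sq_sqrt hn1.le⟩
  rw [← hb2] at hd1
  rw [← ha2] at hd2
  have hsqrt : Real.sqrt (d1 * d2) = e / (a * b) := by
    rw [Real.sqrt_eq_iff_mul_self_eq (by rw [hd1, hd2]; positivity) (by positivity), hd1, hd2]
    field_simp
  have hpsd := (G.isHermitian_adjMatrix ℝ).posSemidef_algebraMap_sub hmax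
  set x : V → ℝ := fun v => if v ∈ V1 then a else b with hx
  have hx1 : ∀ v ∈ V1, x v = a := fun v hv => if_pos hv
  have hx2 : ∀ v ∈ V2, x v = b := fun v hv => if_neg fun h => (hpart v).1 h hv
  have hM1 : ∀ u ∈ V1, ((algebraMap ℝ (Matrix V V ℝ) lam1 - G.adjMatrix ℝ).mulVec x) u
      = lam1 * a - G.degree u * b := fun u hu => by
    rw [Matrix.algebraMap_sub_mulVec_apply, SimpleGraph.adjMatrix_mulVec_apply,
      h12.sum_neighborFinset_eq hx2 hu, hx1 u hu]
  have hM2 : ∀ u ∈ V2, ((algebraMap ℝ (Matrix V V ℝ) lam1 - G.adjMatrix ℝ).mulVec x) u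
      = lam1 * b - G.degree u * a := fun u hu => by
    rw [Matrix.algebraMap_sub_mulVec_apply, SimpleGraph.adjMatrix_mulVec_apply,
      h12.symm.sum_neighborFinset_eq hx1 hu, hx2 u hu]
  have hquad : dotProduct (star x) ((algebraMap ℝ (Matrix V V ℝ) lam1 - G.adjMatrix ℝ).mulVec x)
      = 2 * (a * b) * (lam1 * (a * b) - e) := by
    rw [dotProduct, hsplit, sum_congr rfl fun u hu => by rw [hM1 u hu, Pi.star_apply, hx1 u hu],
      sum_congr (s₁ := V2) rfl fun u hu => by rw [hM2 u hu, Pi.star_apply, hx2 u hu]]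
    simp only [star_trivial, ← mul_sum, sum_sub_distrib, ← sum_mul, sum_const, nsmul_eq_mul, hdeg,
      ← he, ← ha2, ← hb2]
    ring
  have hle : Real.sqrt (d1 * d2) ≤ lam1 := by
    rw [hsqrt, div_le_iff₀ (by positivity)]
    have := hpsd.dotProduct_mulVec_nonneg x
    rw [hquad] at this
    exact sub_nonneg.1 (nonneg_of_mul_nonneg_right this (by positivity))
  refine ⟨hle, fun heq => ?_, fun ⟨h1, h2⟩ => hle.antisymm ?_⟩
  · have heq' : e = lam1 * (a * b) := by
      rw [← heq, hsqrt]
      field_simp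
    have hker := (hpsd.dotProduct_mulVec_zero_iff x).1 (by rw [hquad, heq']; ring)
    refine ⟨fun u hu => ?_, fun u hu => ?_⟩
    · have := hM1 u hu
      rw [hker, Pi.zero_apply] at this
      rw [hd1, heq', eq_div_iff (by positivity)]
      linear_combination b * this
    · have := hM2 u hu
      rw [hker, Pi.zero_apply] at this
      rw [hd2, heq', eq_div_iff (by positivity)]
      linear_combination a * this
  · refine Real.le_sqrt_of_sq_le (G.sq_le_of_mem_spectrum_adjMatrix (fun u => ?_) hmem)
    by_cases hu : u ∈ V1
    · rw [h12.sum_neighborFinset_eq h2 hu, h1 u hu]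
    · have hu2 : u ∈ V2 := by simpa [hcompl] using hu
      rw [h12.symm.sum_neighborFinset_eq h1 hu2, h2 u hu2, mul_comm]
end

section
/- Let Γ be a connected bipartite simple graph on n = n₁ + n₂ vertices with nonempty parts V₁ (of size n₁) and V₂ (of size n₂), adjacency matrix A, distinct adjacency eigenvalues θ₀ > θ₁ > ⋯ > θ_d, preHoffman polynomial H, and let H₁(x) = (H(x) − H(−x))/2 be the odd part of H. Then Γ is (δ₁, δ₂)-biregular for some δ₁, δ₂ if and only if the matrix H₁(A) satisfies (H₁(A))_{uv} = α whenever u and v lie in different parts and (H₁(A))_{uv} = 0 whenever u and v lie in the same part, where α = (n₁ + n₂)/(2·√(n₁·n₂)). Moreover, in that case α also equals (δ₁ + δ₂)/(2·√(δ₁·δ₂)). -/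
open Finset Polynomial

/-- Polynomials that vanish on the spectrum of a Hermitian matrix annihilate it. -/
lemma Matrix.IsHermitian.aeval_eq_zero_of_eval_spectrum {V : Type*} [Fintype V] [DecidableEq V]
    {A : Matrix V V ℝ} (hA : A.IsHermitian) {p : ℝ[X]}
    (hp : ∀ t ∈ spectrum ℝ A, p.eval t = 0) : aeval A p = 0 := by
  rw [← cfc_polynomial p A hA.isSelfAdjoint, cfc_congr (g := fun _ => 0) hp]
  simp

/-- Polynomial evaluation commutes with conjugation by an involution. -/
lemma Polynomial.aeval_conj_involution {R S : Type*} [CommRing R] [Ring S] [Algebra R S]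
    {D : S} (hD : D * D = 1) (A : S) (p : R[X]) :
    aeval (D * A * D) p = D * aeval A p * D := by
  have hpow : ∀ k : ℕ, (D * A * D) ^ k = D * A ^ k * D := by
    intro k
    induction k with
    | zero => simp [hD]
    | succ k ih =>
      calc (D * A * D) ^ (k + 1) = D * A ^ k * (D * D) * A * D := by
            rw [pow_succ, ih]; simp only [mul_assoc]
        _ = D * A ^ (k + 1) * D := by rw [hD, pow_succ]; simp only [mul_assoc, mul_one]
  induction p using Polynomial.induction_on' with
  | add p q hp hq => simp only [map_add, hp, hq, mul_add, add_mul]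
  | monomial k a =>
    rw [aeval_monomial, aeval_monomial, hpow, ← mul_assoc, ← mul_assoc, ← mul_assoc,
      Algebra.commutes a D]

/-- A left eigenvector of `A` is a left eigenvector of every polynomial in `A`. -/
lemma Matrix.vecMul_aeval_of_vecMul_eq_smul {V : Type*} [Fintype V] [DecidableEq V]
    {A : Matrix V V ℝ} {x : V → ℝ} {t : ℝ} (hx : Matrix.vecMul x A = t • x) (p : ℝ[X]) :
    Matrix.vecMul x (aeval A p) = p.eval t • x := by
  obtain ⟨q, hq⟩ := X_sub_C_dvd_sub_C_eval (a := t) (p := p)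
  have h : aeval A p = (A - algebraMap ℝ _ t) * aeval A q + algebraMap ℝ _ (p.eval t) := by
    have := congrArg (aeval A) hq
    simp only [map_sub, map_mul, aeval_X, aeval_C] at this
    rw [← this, sub_add_cancel]
  rw [h, Matrix.vecMul_add, ← Matrix.vecMul_vecMul, Matrix.vecMul_sub, hx]
  simp [Algebra.algebraMap_eq_smul_one, Matrix.vecMul_smul]

/-- In a connected graph with positive eigenvector `x` for `l`, every eigenvector for an
eigenvalue at least `l` is a multiple of `x`. -/
lemma SimpleGraph.Connected.exists_eq_smul_of_pos_eigenvector
    {V : Type*} [Fintype V] {G : SimpleGraph V} [DecidableRel G.Adj]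
    (hconn : G.Connected) {x y : V → ℝ} {l m : ℝ} (hx : ∀ u, 0 < x u)
    (hAx : (G.adjMatrix ℝ).mulVec x = l • x) (hAy : (G.adjMatrix ℝ).mulVec y = m • y)
    (hlm : l ≤ m) : ∃ c : ℝ, y = c • x := by
  classical
  have hx' : ∀ u, x u ≠ 0 := fun u => (hx u).ne'
  set A := G.adjMatrix ℝ with hA
  have hsymm : ∀ u v, A u v = A v u := fun u v => by simp [hA, G.adj_comm]
  have hnn : ∀ u v, 0 ≤ A u v := fun u v => by
    rw [hA, SimpleGraph.adjMatrix_apply]; split_ifs <;> norm_num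
  have e1 : ∀ u, ∑ v, A u v * x v = l * x u := fun u => congrFun hAx u
  have e2 : ∀ u, ∑ v, A u v * y v = m * y u := fun u => congrFun hAy u
  let F : V → V → ℝ := fun u v => A u v * (x u * x v) * (y u / x u - y v / x v) ^ 2
  have hF : ∀ u v, 0 ≤ F u v := fun u v =>
    mul_nonneg (mul_nonneg (hnn u v) (mul_pos (hx u) (hx v)).le) (sq_nonneg _)
  have hFeq : ∀ u v, F u v = (y u ^ 2 / x u) * (A u v * x v) + (y v ^ 2 / x v) * (A v u * x u)
      - 2 * (y u * (A u v * y v)) := by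
    intro u v
    have h1 := hx' u
    have h2 := hx' v
    simp only [F, hsymm v u]
    field_simp
    ring
  have hdiag : ∀ u, (y u ^ 2 / x u) * (l * x u) = l * y u ^ 2 := fun u => by
    have := hx' u
    field_simp
  have hsum : ∑ u, ∑ v, F u v = 2 * (l - m) * ∑ u, y u ^ 2 := by
    have s1 : ∑ u, ∑ v, (y u ^ 2 / x u) * (A u v * x v) = l * ∑ u, y u ^ 2 := by
      rw [Finset.mul_sum]
      refine Finset.sum_congr rfl fun u _ => ?_
      rw [← Finset.mul_sum, e1, hdiag]
    have s2 : ∑ u, ∑ v, (y v ^ 2 / x v) * (A v u * x u) = l * ∑ u, y u ^ 2 := by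
      rw [Finset.sum_comm, s1]
    have s3 : ∑ u, ∑ v, 2 * (y u * (A u v * y v)) = 2 * m * ∑ u, y u ^ 2 := by
      rw [Finset.mul_sum]
      refine Finset.sum_congr rfl fun u _ => ?_
      rw [← Finset.mul_sum, ← Finset.mul_sum, e2]
      ring
    simp only [hFeq, Finset.sum_sub_distrib, Finset.sum_add_distrib, s1, s2, s3]
    ring
  have hzero : ∑ u, ∑ v, F u v = 0 := by
    refine le_antisymm ?_ (Finset.sum_nonneg fun u _ => Finset.sum_nonneg fun v _ => hF u v)
    rw [hsum]
    exact mul_nonpos_of_nonpos_of_nonneg (by linarith) (Finset.sum_nonneg fun u _ => sq_nonneg _)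
  have hFz : ∀ u v, F u v = 0 := by
    intro u v
    have h1 := (Finset.sum_eq_zero_iff_of_nonneg
      (fun u _ => Finset.sum_nonneg fun v _ => hF u v)).1 hzero u (Finset.mem_univ u)
    exact (Finset.sum_eq_zero_iff_of_nonneg (fun v _ => hF u v)).1 h1 v (Finset.mem_univ v)
  have hadj : ∀ u v, G.Adj u v → y u / x u = y v / x v := by
    intro u v huv
    have h := hFz u v
    have hA1 : A u v = 1 := by simp [hA, huv]
    simp only [F, hA1, one_mul] at h
    rcases mul_eq_zero.1 h with h | h
    · exact absurd h (mul_pos (hx u) (hx v)).ne'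
    · exact sub_eq_zero.1 (pow_eq_zero_iff two_ne_zero |>.1 h)
  have hwalk : ∀ u v, G.Walk u v → y u / x u = y v / x v := by
    intro u v w
    induction w with
    | nil => rfl
    | cons h _ ih => exact (hadj _ _ h).trans ih
  obtain ⟨v₀⟩ := hconn.nonempty
  refine ⟨y v₀ / x v₀, funext fun u => ?_⟩
  obtain ⟨w⟩ := hconn.preconnected u v₀
  rw [Pi.smul_apply, smul_eq_mul, ← hwalk u v₀ w, div_mul_cancel₀ _ (hx' u)]

/-- In a connected graph with positive eigenvector `x`, its eigenvalue is the largest one, and a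
polynomial vanishing at all other eigenvalues evaluates to a multiple of `x xᵀ`. -/
lemma SimpleGraph.Connected.aeval_adjMatrix_of_pos_eigenvector
    {V : Type*} [Fintype V] [DecidableEq V] {G : SimpleGraph V} [DecidableRel G.Adj]
    (hconn : G.Connected) {x : V → ℝ} {l t : ℝ} (hx : ∀ u, 0 < x u)
    (hAx : (G.adjMatrix ℝ).mulVec x = l • x)
    (ht : IsGreatest (spectrum ℝ (G.adjMatrix ℝ)) t) {p : ℝ[X]}
    (hp : ∀ s ∈ spectrum ℝ (G.adjMatrix ℝ), s ≠ t → p.eval s = 0) (u v : V) :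
    (aeval (G.adjMatrix ℝ) p) u v = p.eval t * (x u * x v) / ∑ w, x w ^ 2 := by
  obtain ⟨v₀⟩ := hconn.nonempty
  have hmem : ∀ s, s ∈ spectrum ℝ (G.adjMatrix ℝ) ↔
      ∃ y, (G.adjMatrix ℝ).mulVec y = s • y ∧ y ≠ 0 := by
    intro s
    rw [← Matrix.spectrum_toLin', ← Module.End.hasEigenvalue_iff_mem_spectrum]
    constructor
    · intro h
      obtain ⟨y, hy⟩ := h.exists_hasEigenvector
      exact ⟨y, by simpa using hy.apply_eq_smul, hy.2⟩
    · rintro ⟨y, hy, hy0⟩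
      exact Module.End.hasEigenvalue_of_hasEigenvector
        (x := y) ⟨Module.End.mem_eigenspace_iff.2 (by simpa using hy), hy0⟩
  have hlt : l ≤ t := ht.2 ((hmem l).2 ⟨x, hAx, fun h => (hx v₀).ne' (congrFun h v₀)⟩)
  have htl : t = l := by
    obtain ⟨y, hy, hy0⟩ := (hmem t).1 ht.1
    obtain ⟨c, rfl⟩ := hconn.exists_eq_smul_of_pos_eigenvector hx hAx hy hlt
    have hc : c ≠ 0 := by rintro rfl; simp at hy0
    rw [Matrix.mulVec_smul, hAx] at hy
    have := congrFun hy v₀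
    simp only [Pi.smul_apply, smul_eq_mul] at this
    have hne : c * x v₀ ≠ 0 := mul_ne_zero hc (hx v₀).ne'
    apply mul_right_cancel₀ hne
    linarith
  subst htl
  set A := G.adjMatrix ℝ with hA
  have hherm : A.IsHermitian := by
    rw [Matrix.IsHermitian, Matrix.conjTranspose_eq_transpose_of_trivial]
    exact G.transpose_adjMatrix
  have hann : A * aeval A p = t • aeval A p := by
    have h := hherm.aeval_eq_zero_of_eval_spectrum (p := (X - C t) * p) (by
      intro s hs
      by_cases hst : s = t
      · simp [hst]
      · simp [hp s hs hst])
    rw [map_mul, map_sub, aeval_X, aeval_C, sub_mul, sub_eq_zero] at h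
    rw [h, Algebra.algebraMap_eq_smul_one, smul_mul_assoc, one_mul]
  obtain ⟨c, hc⟩ := hconn.exists_eq_smul_of_pos_eigenvector
    (y := fun w => aeval A p w v) hx hAx (m := t) (funext fun w => congrFun (congrFun hann w) v)
    le_rfl
  have hleft : Matrix.vecMul x A = t • x := by
    rw [← hAx, ← Matrix.mulVec_transpose, hA, G.transpose_adjMatrix]
  have hv := congrFun (Matrix.vecMul_aeval_of_vecMul_eq_smul hleft p) v
  have hcw : ∀ w, aeval A p w v = c * x w := fun w => congrFun hc w
  simp only [Matrix.vecMul, dotProduct, hcw, Pi.smul_apply, smul_eq_mul] at hv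
  have hS : 0 < ∑ w, x w ^ 2 :=
    Finset.sum_pos (fun w _ => pow_pos (hx w) 2) ⟨v₀, Finset.mem_univ _⟩
  have hcS : c * ∑ w, x w ^ 2 = p.eval t * x v := by
    rw [← hv, Finset.mul_sum]
    exact Finset.sum_congr rfl fun w _ => by ring
  rw [hcw, eq_div_iff hS.ne']
  linear_combination x u * hcS

/-- A connected bipartite graph with parts `V1`, `V2` (of sizes `n1`, `n2`),
distinct eigenvalues `θ 0 > θ 1 > ⋯ > θ d` and preHoffman polynomial `H` with odd part `H1`
is biregular iff `H1(A)` has entry `α = (n1+n2)/(2√(n1·n2))` between vertices of different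
parts and `0` between vertices of the same part; moreover in that case
`α = (δ1+δ2)/(2√(δ1·δ2))` for the degrees `δ1`, `δ2`. -/
theorem bipartite_biregular_iff_oddPart_preHoffman
    {V : Type*} [Fintype V] [DecidableEq V]
    (G : SimpleGraph V) [DecidableRel G.Adj] (hconn : G.Connected)
    (V1 V2 : Finset V) (hV1 : V1.Nonempty) (hV2 : V2.Nonempty)
    (hpart : ∀ v, v ∈ V1 ↔ v ∉ V2)
    (hbip : ∀ u v, G.Adj u v → ((u ∈ V1 ∧ v ∈ V2) ∨ (u ∈ V2 ∧ v ∈ V1)))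
    (d : ℕ) (θ : Fin (d + 1) → ℝ) (hθ : StrictAnti θ)
    (hspec : spectrum ℝ (G.adjMatrix ℝ) = Set.range θ)
    (H : ℝ[X]) (hHdeg : H.degree ≤ (d : ℕ))
    (hH0 : H.eval (θ 0) = (Fintype.card V : ℝ))
    (hHi : ∀ i : Fin (d + 1), i ≠ 0 → H.eval (θ i) = 0)
    (H1 : ℝ[X]) (hH1 : H1 = Polynomial.C (1 / 2 : ℝ) * (H - H.comp (-Polynomial.X)))
    (α : ℝ)
    (hα : α = ((V1.card : ℝ) + (V2.card : ℝ)) /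
              (2 * Real.sqrt ((V1.card : ℝ) * (V2.card : ℝ)))) :
    ((∃ δ1 δ2 : ℕ, (∀ u ∈ V1, G.degree u = δ1) ∧ (∀ u ∈ V2, G.degree u = δ2)) ↔
      (∀ u v : V, (Polynomial.aeval (G.adjMatrix ℝ) H1) u v =
        if (u ∈ V1 ↔ v ∈ V1) then 0 else α)) ∧
    (∀ δ1 δ2 : ℕ, (∀ u ∈ V1, G.degree u = δ1) → (∀ u ∈ V2, G.degree u = δ2) →
      α = ((δ1 : ℝ) + (δ2 : ℝ)) / (2 * Real.sqrt ((δ1 : ℝ) * (δ2 : ℝ)))) := by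
  classical
  have hmem : ∀ u, u ∈ V2 ↔ u ∉ V1 := fun u => by rw [hpart]; exact not_not.symm
  clear hpart
  have hV : V2 = V1ᶜ := by ext u; rw [Finset.mem_compl, hmem]
  have hn1 : (0 : ℝ) < #V1 := by exact_mod_cast hV1.card_pos
  have hn2 : (0 : ℝ) < #V2 := by exact_mod_cast hV2.card_pos
  have hαpos : 0 < α := by rw [hα]; positivity
  have hadj : ∀ u v, G.Adj u v → (u ∈ V1 ↔ v ∉ V1) := by
    intro u v huv
    have := hbip u v huv
    rw [hmem, hmem] at this
    tauto
  set A := G.adjMatrix ℝ with hA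
  have hcount : ∀ δ1 δ2 : ℕ, (∀ u ∈ V1, G.degree u = δ1) → (∀ u ∈ V2, G.degree u = δ2) →
      (#V1 : ℝ) * δ1 = #V2 * δ2 ∧ (0 : ℝ) < δ1 ∧ (0 : ℝ) < δ2 := by
    intro δ1 δ2 h1 h2
    have hb : G.IsBipartiteWith (V1 : Set V) (V2 : Set V) := by
      refine ⟨?_, fun u v huv => by simpa using hbip u v huv⟩
      rw [Finset.disjoint_coe, hV]
      exact disjoint_compl_right
    have hs := SimpleGraph.isBipartiteWith_sum_degrees_eq hb
    rw [Finset.sum_congr rfl h1, Finset.sum_congr rfl h2] at hs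
    simp only [Finset.sum_const, smul_eq_mul] at hs
    obtain ⟨a, ha⟩ := hV1
    obtain ⟨b, hb⟩ := hV2
    have : Nontrivial V := ⟨a, b, fun h => (hmem b).1 hb (h ▸ ha)⟩
    refine ⟨by exact_mod_cast hs, ?_, ?_⟩
    · rw [← h1 a ha]; exact_mod_cast hconn.preconnected.degree_pos_of_nontrivial a
    · rw [← h2 b hb]; exact_mod_cast hconn.preconnected.degree_pos_of_nontrivial b
  have hα' : ∀ δ1 δ2 : ℕ, (∀ u ∈ V1, G.degree u = δ1) → (∀ u ∈ V2, G.degree u = δ2) →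
      α = ((δ1 : ℝ) + (δ2 : ℝ)) / (2 * Real.sqrt ((δ1 : ℝ) * (δ2 : ℝ))) := by
    intro δ1 δ2 h1 h2
    obtain ⟨hc, hp1, hp2⟩ := hcount δ1 δ2 h1 h2
    obtain ⟨k, hk⟩ : ∃ k : ℝ, (δ1 : ℝ) = k * #V2 := ⟨δ1 / #V2, by field_simp⟩
    have hk2 : (δ2 : ℝ) = k * #V1 := by
      apply mul_left_cancel₀ hn2.ne'
      rw [← hc, hk]; ring
    have hkpos : 0 < k := by
      rw [hk] at hp1
      exact pos_of_mul_pos_left hp1 hn2.le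
    have hsq : Real.sqrt ((δ1 : ℝ) * δ2) = k * Real.sqrt ((#V1 : ℝ) * #V2) := by
      rw [hk, hk2, show k * (#V2 : ℝ) * (k * #V1) = k ^ 2 * (#V1 * #V2) by ring,
        Real.sqrt_mul (sq_nonneg k), Real.sqrt_sq hkpos.le]
    rw [hsq, hk, hk2, hα]
    have : 0 < Real.sqrt ((#V1 : ℝ) * #V2) := by positivity
    field_simp
    ring
  refine ⟨⟨?_, ?_⟩, hα'⟩
  · rintro ⟨δ1, δ2, h1, h2⟩ u v
    obtain ⟨hc, hp1, hp2⟩ := hcount δ1 δ2 h1 h2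
    set x : V → ℝ := fun w => if w ∈ V1 then Real.sqrt δ1 else Real.sqrt δ2 with hx
    have hxpos : ∀ w, 0 < x w := by
      intro w
      simp only [hx]
      split_ifs <;> positivity
    have hAx : A.mulVec x = (Real.sqrt δ1 * Real.sqrt δ2) • x := by
      funext w
      rw [hA, SimpleGraph.adjMatrix_mulVec_apply, Pi.smul_apply, smul_eq_mul]
      have q1 : Real.sqrt δ1 * Real.sqrt δ1 = δ1 := Real.mul_self_sqrt hp1.le
      have q2 : Real.sqrt δ2 * Real.sqrt δ2 = δ2 := Real.mul_self_sqrt hp2.le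
      by_cases hw : w ∈ V1
      · have : ∀ z ∈ G.neighborFinset w, x z = Real.sqrt δ2 := by
          intro z hz
          have := (hadj w z ((G.mem_neighborFinset w z).1 hz)).1 hw
          simp [hx, this]
        rw [Finset.sum_congr rfl this, Finset.sum_const, G.card_neighborFinset_eq_degree, h1 w hw]
        simp only [hx, hw, if_true, nsmul_eq_mul]
        linear_combination -Real.sqrt δ2 * q1
      · have : ∀ z ∈ G.neighborFinset w, x z = Real.sqrt δ1 := by
          intro z hz
          have := (hadj z w ((G.mem_neighborFinset w z).1 hz).symm).2 hw
          simp [hx, this]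
        rw [Finset.sum_congr rfl this, Finset.sum_const, G.card_neighborFinset_eq_degree,
          h2 w ((hmem w).2 hw)]
        simp only [hx, hw, if_false, nsmul_eq_mul]
        linear_combination -Real.sqrt δ1 * q2
    have hgreat : IsGreatest (spectrum ℝ A) (θ 0) := by
      rw [hspec]
      refine ⟨⟨0, rfl⟩, ?_⟩
      rintro _ ⟨i, rfl⟩
      exact hθ.antitone (Fin.zero_le i)
    have hvan : ∀ s ∈ spectrum ℝ A, s ≠ θ 0 → H.eval s = 0 := by
      rw [hspec]
      rintro _ ⟨i, rfl⟩ hi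
      exact hHi i fun h => hi (by rw [h])
    have hHA := hconn.aeval_adjMatrix_of_pos_eigenvector hxpos hAx hgreat hvan
    have hcard : (Fintype.card V : ℝ) = #V1 + #V2 := by
      rw [hV, ← Finset.card_add_card_compl V1]
      push_cast
      rfl
    have hxsq : ∑ w, x w ^ 2 = 2 * (#V1 * δ1) := by
      rw [← Finset.sum_add_sum_compl V1, ← hV]
      have a1 : ∀ w ∈ V1, x w ^ 2 = δ1 := fun w hw => by simp [hx, hw]
      have a2 : ∀ w ∈ V2, x w ^ 2 = δ2 := fun w hw => by simp [hx, (hmem w).1 hw]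
      rw [Finset.sum_congr rfl a1, Finset.sum_congr rfl a2]
      simp only [Finset.sum_const, nsmul_eq_mul]
      linarith
    set s : V → ℝ := fun w => if w ∈ V1 then 1 else -1 with hs
    have hD : Matrix.diagonal s * Matrix.diagonal s = 1 := by
      rw [Matrix.diagonal_mul_diagonal, ← Matrix.diagonal_one]
      congr 1
      funext w
      simp only [hs]
      split_ifs <;> norm_num
    have hneg : -A = Matrix.diagonal s * A * Matrix.diagonal s := by
      ext a b
      rw [Matrix.mul_diagonal, Matrix.diagonal_mul, Matrix.neg_apply, hA,
        SimpleGraph.adjMatrix_apply]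
      by_cases hab : G.Adj a b
      · have := hadj a b hab
        by_cases hb : b ∈ V1 <;> simp_all
      · simp [hab]
    have hH1A : aeval A H1 u v = 1 / 2 * (aeval A H u v - s u * aeval A H u v * s v) := by
      rw [hH1, map_mul, map_sub, aeval_comp, map_neg, aeval_X, aeval_C, hneg,
        aeval_conj_involution hD, Algebra.algebraMap_eq_smul_one, smul_mul_assoc, one_mul,
        Matrix.smul_apply, Matrix.sub_apply, Matrix.mul_diagonal, Matrix.diagonal_mul, smul_eq_mul]
    have hval : (Fintype.card V : ℝ) * (Real.sqrt δ1 * Real.sqrt δ2) / (2 * (#V1 * δ1)) = α := by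
      rw [hα' δ1 δ2 h1 h2, Real.sqrt_mul hp1.le, hcard]
      have q1 : Real.sqrt δ1 ^ 2 = δ1 := Real.sq_sqrt hp1.le
      have q2 : Real.sqrt δ2 ^ 2 = δ2 := Real.sq_sqrt hp2.le
      have p1 : 0 < Real.sqrt δ1 := by positivity
      have p2 : 0 < Real.sqrt δ2 := by positivity
      rw [div_eq_div_iff (by positivity) (by positivity)]
      have : (Real.sqrt δ1 * Real.sqrt δ2) * (Real.sqrt δ1 * Real.sqrt δ2) = δ1 * δ2 := by
        rw [← q1, ← q2]; simp only [Real.sqrt_sq p1.le, Real.sqrt_sq p2.le]; ring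
      linear_combination 2 * (#V1 + #V2 : ℝ) * this - 2 * δ1 * hc
    rw [hH1A, hHA, hH0, hxsq]
    by_cases hu : u ∈ V1 <;> by_cases hv : v ∈ V1
    · simp [hs, hu, hv]
    · simp only [hs, hx, hu, hv, if_true, if_false, iff_false, not_true]
      rw [← hval]; ring
    · simp only [hs, hx, hu, hv, if_true, if_false, iff_true]
      rw [← hval]; ring
    · simp [hs, hu, hv]
  · intro h
    have hcomm : A * aeval A H1 = aeval A H1 * A := by
      have := congrArg (aeval A) (mul_comm X H1)
      simpa using this
    have hl : ∀ u v, (u ∈ V1 ↔ v ∈ V1) → (A * aeval A H1) u v = G.degree u * α := by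
      intro u v huv
      rw [hA, SimpleGraph.adjMatrix_mul_apply, ← G.card_neighborFinset_eq_degree, ← nsmul_eq_mul,
        ← Finset.sum_const]
      refine Finset.sum_congr rfl fun w hw => ?_
      have := hadj u w ((G.mem_neighborFinset u w).1 hw)
      rw [h, if_neg (by tauto)]
    have hr : ∀ u v, (u ∈ V1 ↔ v ∈ V1) → (aeval A H1 * A) u v = G.degree v * α := by
      intro u v huv
      rw [hA, SimpleGraph.mul_adjMatrix_apply, ← G.card_neighborFinset_eq_degree, ← nsmul_eq_mul,
        ← Finset.sum_const]
      refine Finset.sum_congr rfl fun w hw => ?_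
      have := hadj v w ((G.mem_neighborFinset v w).1 hw)
      rw [h, if_neg (by tauto)]
    have hdeg : ∀ u v, (u ∈ V1 ↔ v ∈ V1) → G.degree u = G.degree v := by
      intro u v huv
      have := hl u v huv
      rw [hcomm, hr u v huv] at this
      exact_mod_cast (mul_right_cancel₀ hαpos.ne' this).symm
    obtain ⟨a, ha⟩ := hV1
    obtain ⟨b, hb⟩ := hV2
    refine ⟨G.degree a, G.degree b, fun u hu => hdeg u a (by simp [hu, ha]), fun u hu => ?_⟩
    have hu' := (hmem u).1 hu
    have hb' := (hmem b).1 hb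
    exact hdeg u b (by simp [hu', hb'])
end

section
/- Let Γ be a finite bipartite simple graph with nonempty parts V₁, V₂ and adjacency matrix A. Then Γ is connected and biregular (every vertex of V₁ has the same degree δ₁ and every vertex of V₂ has the same degree δ₂) if and only if there exists a real polynomial P such that (P(A))_{uv} = 1 whenever u and v lie in different parts and (P(A))_{uv} = 0 whenever u and v lie in the same part. -/
open Finset Polynomial

open Matrix

theorem Matrix.IsSymm.aeval {n R : Type*} [Fintype n] [DecidableEq n] [CommRing R]
    {M : Matrix n n R} (hM : M.IsSymm) (p : R[X]) : (Polynomial.aeval M p).IsSymm := by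
  induction p using Polynomial.induction_on' with
  | add p q hp hq => rw [map_add]; exact hp.add hq
  | monomial k a =>
    rw [aeval_monomial, ← Algebra.smul_def]
    exact (hM.pow k).smul a

theorem Matrix.IsSymm.mul_eq_zero_of_pow_mul_eq_zero {n : Type*} [Fintype n] [DecidableEq n]
    {M Y : Matrix n n ℝ} (hM : M.IsSymm) (k : ℕ) (h : M ^ k * Y = 0) : M * Y = 0 := by
  induction k with
  | zero => rw [pow_zero, one_mul] at h; rw [h, mul_zero]
  | succ k ih =>
    obtain _ | k := k
    · simpa using h
    · apply ih
      have hH : Mᴴ = M := by rw [conjTranspose_eq_transpose_of_trivial, hM.eq]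
      have key := conjTranspose_mul_self_mul_eq_zero M (M ^ k * Y)
      rw [hH] at key
      rw [pow_succ', mul_assoc]
      apply key.mp
      rw [← h, pow_succ', pow_succ']
      simp only [mul_assoc]

/-- A real symmetric matrix has, for each real `c`, a polynomial not vanishing at `c` whose value
at the matrix maps into the `c`-eigenspace. -/
theorem Matrix.IsSymm.exists_eval_ne_zero_mul_aeval_eq_smul {n : Type*} [Fintype n] [DecidableEq n]
    {M : Matrix n n ℝ} (hM : M.IsSymm) (c : ℝ) :
    ∃ r : ℝ[X], r.eval c ≠ 0 ∧ M * Polynomial.aeval M r = c • Polynomial.aeval M r := by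
  obtain ⟨r, hr, hdvd⟩ :=
    M.charpoly.exists_eq_pow_rootMultiplicity_mul_and_not_dvd M.charpoly_monic.ne_zero c
  refine ⟨r, fun h ↦ hdvd (dvd_iff_isRoot.mpr h), ?_⟩
  have h0 := M.aeval_self_charpoly
  rw [hr, map_mul, map_pow] at h0
  have h1 := (hM.aeval (X - C c)).mul_eq_zero_of_pow_mul_eq_zero _ h0
  rw [map_sub, aeval_X, aeval_C, sub_mul, sub_eq_zero, ← Algebra.smul_def] at h1
  exact h1

theorem Matrix.aeval_mulVec_of_mulVec_eq_smul {n R : Type*} [Fintype n] [DecidableEq n]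
    [CommRing R] {M : Matrix n n R} {x : n → R} {c : R} (h : M *ᵥ x = c • x) (p : R[X]) :
    Polynomial.aeval M p *ᵥ x = p.eval c • x := by
  induction p using Polynomial.induction_on' with
  | add p q hp hq => rw [map_add, add_mulVec, hp, hq, eval_add, add_smul]
  | monomial k a =>
    have hk : M ^ k *ᵥ x = c ^ k • x := by
      induction k with
      | zero => simp
      | succ k ih => rw [pow_succ, ← mulVec_mulVec, h, mulVec_smul, ih, smul_smul, pow_succ']
    rw [aeval_monomial, ← Algebra.smul_def, smul_mulVec, hk, smul_smul, eval_monomial]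

namespace SimpleGraph

variable {V : Type*} [Fintype V] [DecidableEq V] {G : SimpleGraph V} [DecidableRel G.Adj]

theorem aeval_adjMatrix_apply_eq_zero_of_not_reachable {R : Type*} [CommRing R] {u v : V}
    (h : ¬ G.Reachable u v) (p : R[X]) : Polynomial.aeval (G.adjMatrix R) p u v = 0 := by
  induction p using Polynomial.induction_on' with
  | add p q hp hq => rw [map_add, Matrix.add_apply, hp, hq, add_zero]
  | monomial k a =>
    have : IsEmpty (G.Walk u v) := not_nonempty_iff.mp h
    rw [aeval_monomial, ← Algebra.smul_def, Matrix.smul_apply, adjMatrix_pow_apply_eq_card_walk]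
    simp

/-- In a bipartite graph, odd polynomials of the adjacency matrix vanish within each part. -/
theorem adjMatrix_mul_aeval_sq_apply_eq_zero {S : Finset V}
    (hS : ∀ u v, G.Adj u v → (u ∈ S ↔ v ∉ S)) (r : ℝ[X]) {u v : V} (huv : u ∈ S ↔ v ∈ S) :
    (G.adjMatrix ℝ * Polynomial.aeval (G.adjMatrix ℝ ^ 2) r) u v = 0 := by
  set A := G.adjMatrix ℝ
  let s : V → ℝ := fun w ↦ if w ∈ S then 1 else -1
  have hA : diagonal s * A = -(A * diagonal s) := by
    ext i j
    rw [Matrix.neg_apply, diagonal_mul, mul_diagonal]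
    by_cases hij : G.Adj i j
    · have := hS i j hij
      by_cases hj : j ∈ S <;> simp_all [s]
    · simp [A, adjMatrix_apply, hij]
  have hA2 : Commute (diagonal s) (A ^ 2) := by
    rw [Commute, SemiconjBy, sq, ← mul_assoc, hA, neg_mul, mul_assoc, hA, mul_neg, neg_neg,
      mul_assoc]
  have hr : Commute (diagonal s) (Polynomial.aeval (A ^ 2) r) := by
    induction r using Polynomial.induction_on' with
    | add p q hp hq => rw [map_add]; exact hp.add_right hq
    | monomial k a =>
      rw [aeval_monomial, ← Algebra.smul_def]
      exact (hA2.pow_right k).smul_right a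
  have key : diagonal s * (A * Polynomial.aeval (A ^ 2) r) =
      -(A * Polynomial.aeval (A ^ 2) r * diagonal s) := by
    rw [← mul_assoc, hA, neg_mul, mul_assoc, hr.eq, mul_assoc]
  have := congrFun (congrFun key u) v
  rw [Matrix.neg_apply, diagonal_mul, mul_diagonal] at this
  by_cases hv : v ∈ S
  · simp only [s, huv.mpr hv, hv, if_true] at this
    linarith
  · simp only [s, mt huv.mp hv, hv, if_false] at this
    linarith

/-- In a connected biregular bipartite graph, the `δ₁ δ₂`-eigenvectors of the squared adjacency
matrix are constant on each part. -/
theorem Connected.eq_of_adjMatrix_mulVec_mulVec_eq_smul (hG : G.Connected) {S : Finset V}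
    (hS : ∀ u v, G.Adj u v → (u ∈ S ↔ v ∉ S)) {δ₁ δ₂ : ℕ} (hδ : δ₂ ≠ 0)
    (h₁ : ∀ u ∈ S, G.degree u = δ₁) (h₂ : ∀ u ∉ S, G.degree u = δ₂) {x : V → ℝ}
    (hx : G.adjMatrix ℝ *ᵥ (G.adjMatrix ℝ *ᵥ x) = ((δ₁ : ℝ) * δ₂) • x) {u v : V}
    (hu : u ∈ S) (hv : v ∈ S) : x u = x v := by
  set y := G.adjMatrix ℝ *ᵥ x with hy
  let z : V → ℝ := fun w ↦ if w ∈ S then δ₂ * x w else y w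
  have hz : G.lapMatrix ℝ *ᵥ z = 0 := by
    ext w
    rw [lapMatrix_mulVec_apply, Pi.zero_apply, sub_eq_zero]
    by_cases hw : w ∈ S
    · have hsum : ∑ a ∈ G.neighborFinset w, z a = ∑ a ∈ G.neighborFinset w, y a :=
        Finset.sum_congr rfl fun a ha ↦
          if_neg ((hS w a ((G.mem_neighborFinset w a).mp ha)).mp hw)
      have hw' := congrFun hx w
      rw [adjMatrix_mulVec_apply, Pi.smul_apply, smul_eq_mul] at hw'
      rw [hsum, hw', h₁ w hw]
      simp only [z, if_pos hw]
      ring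
    · have hsum : ∑ a ∈ G.neighborFinset w, z a = ∑ a ∈ G.neighborFinset w, δ₂ * x a :=
        Finset.sum_congr rfl fun a ha ↦
          if_pos ((hS a w ((G.mem_neighborFinset w a).mp ha).symm).mpr hw)
      rw [hsum, ← Finset.mul_sum, h₂ w hw, ← adjMatrix_mulVec_apply, ← hy]
      simp only [z, if_neg hw]
  have huv := (G.lapMatrix_mulVec_eq_zero_iff_forall_reachable).mp hz u v (hG.preconnected u v)
  simp only [z, if_pos hu, if_pos hv] at huv
  exact mul_left_cancel₀ (Nat.cast_ne_zero.mpr hδ) huv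

theorem Connected.exists_aeval_adjMatrix_eq_of_biregular (hG : G.Connected) {S : Finset V}
    (hS : ∀ u v, G.Adj u v → (u ∈ S ↔ v ∉ S)) {a b : V} (ha : a ∈ S) (hb : b ∉ S) {δ₁ δ₂ : ℕ}
    (h₁ : ∀ u ∈ S, G.degree u = δ₁) (h₂ : ∀ u ∉ S, G.degree u = δ₂) :
    ∃ P : ℝ[X], ∀ u v : V,
      Polynomial.aeval (G.adjMatrix ℝ) P u v = if (u ∈ S ↔ v ∈ S) then 0 else 1 := by
  have : Nontrivial V := ⟨a, b, fun h ↦ hb (h ▸ ha)⟩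
  have hδ₁ : δ₁ ≠ 0 := h₁ a ha ▸ (hG.preconnected.degree_pos_of_nontrivial a).ne'
  have hδ₂ : δ₂ ≠ 0 := h₂ b hb ▸ (hG.preconnected.degree_pos_of_nontrivial b).ne'
  set A := G.adjMatrix ℝ with hA
  have hAs : A.IsSymm := G.isSymm_adjMatrix
  obtain ⟨r, hr, hmul⟩ := (hAs.pow 2).exists_eval_ne_zero_mul_aeval_eq_smul ((δ₁ : ℝ) * δ₂)
  let Q : ℝ[X] := X * r.comp (X ^ 2)
  have hQ : Polynomial.aeval A Q = A * Polynomial.aeval (A ^ 2) r := by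
    simp [Q, aeval_comp]
  set N := Polynomial.aeval A Q with hN
  have hNs : N.IsSymm := hAs.aeval Q
  have hcol (v : V) : A *ᵥ (A *ᵥ (fun w ↦ N w v)) = ((δ₁ : ℝ) * δ₂) • fun w ↦ N w v := by
    have hAN : A * (A * N) = ((δ₁ : ℝ) * δ₂) • N := by
      rw [hQ, ← mul_smul_comm, ← hmul, sq]
      simp only [mul_assoc]
    ext w
    exact congrFun (congrFun hAN w) v
  have hc₁ {u u' : V} (v : V) (hu : u ∈ S) (hu' : u' ∈ S) : N u v = N u' v :=
    hG.eq_of_adjMatrix_mulVec_mulVec_eq_smul hS hδ₂ h₁ h₂ (hcol v) hu hu'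
  have hc₂ {u u' : V} (v : V) (hu : u ∉ S) (hu' : u' ∉ S) : N u v = N u' v := by
    refine hG.eq_of_adjMatrix_mulVec_mulVec_eq_smul (S := Sᶜ) (δ₁ := δ₂) (δ₂ := δ₁) ?_ hδ₁
      ?_ ?_ (x := fun w ↦ N w v) ?_ (Finset.mem_compl.mpr hu) (Finset.mem_compl.mpr hu')
    · intro p q hpq
      have := hS p q hpq
      simp only [Finset.mem_compl]
      tauto
    · simpa using h₂
    · simpa using h₁
    · rw [mul_comm (δ₂ : ℝ)]
      exact hcol v
  have hdiag {u v : V} (huv : u ∈ S ↔ v ∈ S) : N u v = 0 := by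
    rw [hQ]
    exact adjMatrix_mul_aeval_sq_apply_eq_zero hS r huv
  have hoff {u v : V} (hu : u ∈ S) (hv : v ∉ S) : N u v = N a b := by
    rw [hc₁ v hu ha, ← hNs.apply, hc₂ a hv hb, hNs.apply]
  have hoff' {u v : V} (hu : u ∉ S) (hv : v ∈ S) : N u v = N a b := by
    rw [← hNs.apply, hoff hv hu]
  have hne : N a b ≠ 0 := by
    intro h0
    have hN0 : N = 0 := by
      ext u v
      rw [Matrix.zero_apply]
      by_cases hu : u ∈ S <;> by_cases hv : v ∈ S
      · exact hdiag (by tauto)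
      · rw [hoff hu hv, h0]
      · rw [hoff' hu hv, h0]
      · exact hdiag (by tauto)
    have hA1 (w : V) : (A *ᵥ 1) w = G.degree w := by
      rw [hA, adjMatrix_mulVec_apply]
      simp
    have hone : A ^ 2 *ᵥ 1 = ((δ₁ : ℝ) * δ₂) • (1 : V → ℝ) := by
      ext w
      rw [sq, ← mulVec_mulVec, hA, adjMatrix_mulVec_apply, ← hA]
      simp only [hA1, Pi.smul_apply, Pi.one_apply, smul_eq_mul, mul_one]
      by_cases hw : w ∈ S
      · rw [Finset.sum_congr rfl fun q hq ↦ by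
          rw [h₂ q ((hS w q ((G.mem_neighborFinset w q).mp hq)).mp hw)]]
        simp [h₁ w hw]
      · rw [Finset.sum_congr rfl fun q hq ↦ by
          rw [h₁ q ((hS q w ((G.mem_neighborFinset w q).mp hq).symm).mpr hw)]]
        simp [h₂ w hw, mul_comm]
    have hN1 : (N *ᵥ 1) a = r.eval ((δ₁ : ℝ) * δ₂) * δ₁ := by
      rw [hQ, ← mulVec_mulVec, aeval_mulVec_of_mulVec_eq_smul hone, mulVec_smul, Pi.smul_apply,
        hA1, h₁ a ha, smul_eq_mul]
    rw [hN0, zero_mulVec, Pi.zero_apply] at hN1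
    exact mul_ne_zero hr (Nat.cast_ne_zero.mpr hδ₁) hN1.symm
  refine ⟨(N a b)⁻¹ • Q, fun u v ↦ ?_⟩
  rw [map_smul, ← hN, Matrix.smul_apply, smul_eq_mul]
  by_cases hu : u ∈ S <;> by_cases hv : v ∈ S
  · simp [hu, hv, hdiag (u := u) (v := v) (by tauto)]
  · simp [hu, hv, hoff hu hv, hne]
  · simp [hu, hv, hoff' hu hv, hne]
  · simp [hu, hv, hdiag (u := u) (v := v) (by tauto)]

theorem connected_of_aeval_adjMatrix_eq {S : Finset V} {a b : V} (ha : a ∈ S) (hb : b ∉ S)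
    {P : ℝ[X]} (hP : ∀ u v : V,
      Polynomial.aeval (G.adjMatrix ℝ) P u v = if (u ∈ S ↔ v ∈ S) then 0 else 1) :
    G.Connected := by
  have hcross {u v : V} (h : ¬ (u ∈ S ↔ v ∈ S)) : G.Reachable u v := by
    by_contra hn
    have h0 := aeval_adjMatrix_apply_eq_zero_of_not_reachable hn P
    rw [hP, if_neg h] at h0
    exact one_ne_zero h0
  have : Nonempty V := ⟨a⟩
  refine ⟨fun u v ↦ ?_⟩
  by_cases h : u ∈ S ↔ v ∈ S
  · by_cases hu : u ∈ S
    · exact (hcross (v := b) (by tauto)).trans (hcross (by tauto))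
    · exact (hcross (v := a) (by tauto)).trans (hcross (by tauto))
  · exact hcross h

theorem degree_eq_of_aeval_adjMatrix_eq {S : Finset V}
    (hS : ∀ u v, G.Adj u v → (u ∈ S ↔ v ∉ S)) {P : ℝ[X]} (hP : ∀ u v : V,
      Polynomial.aeval (G.adjMatrix ℝ) P u v = if (u ∈ S ↔ v ∈ S) then 0 else 1) {u v : V}
    (huv : u ∈ S ↔ v ∈ S) : G.degree u = G.degree v := by
  have hcomm : G.adjMatrix ℝ * Polynomial.aeval (G.adjMatrix ℝ) P =
      Polynomial.aeval (G.adjMatrix ℝ) P * G.adjMatrix ℝ := by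
    nth_rewrite 1 [← aeval_X (R := ℝ) (G.adjMatrix ℝ)]
    rw [← map_mul, mul_comm, map_mul, aeval_X]
  have h := congrFun (congrFun hcomm u) v
  rw [adjMatrix_mul_apply, mul_adjMatrix_apply] at h
  have hleft : ∀ w ∈ G.neighborFinset u, Polynomial.aeval (G.adjMatrix ℝ) P w v = 1 := by
    intro w hw
    have := hS u w ((G.mem_neighborFinset u w).mp hw)
    rw [hP, if_neg (by tauto)]
  have hright : ∀ w ∈ G.neighborFinset v, Polynomial.aeval (G.adjMatrix ℝ) P u w = 1 := by
    intro w hw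
    have := hS v w ((G.mem_neighborFinset v w).mp hw)
    rw [hP, if_neg (by tauto)]
  rw [Finset.sum_congr rfl hleft, Finset.sum_congr rfl hright] at h
  simpa using h

end SimpleGraph

/-- A finite bipartite simple graph with nonempty parts `V1`, `V2` is
connected and biregular iff there is a real polynomial `P` such that `P(A)` has all entries
equal to `1` between the two parts and `0` within each part. -/
theorem connected_biregular_iff_exists_polynomial
    {V : Type*} [Fintype V] [DecidableEq V]
    (G : SimpleGraph V) [DecidableRel G.Adj]
    (V1 V2 : Finset V) (hV1 : V1.Nonempty) (hV2 : V2.Nonempty)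
    (hpart : ∀ v, v ∈ V1 ↔ v ∉ V2)
    (hbip : ∀ u v, G.Adj u v → ((u ∈ V1 ∧ v ∈ V2) ∨ (u ∈ V2 ∧ v ∈ V1))) :
    (G.Connected ∧
        ∃ δ1 δ2 : ℕ, (∀ u ∈ V1, G.degree u = δ1) ∧ (∀ u ∈ V2, G.degree u = δ2)) ↔
      ∃ P : ℝ[X], ∀ u v : V,
        (Polynomial.aeval (G.adjMatrix ℝ) P) u v = if (u ∈ V1 ↔ v ∈ V1) then 0 else 1 := by
  obtain ⟨a, ha⟩ := hV1
  obtain ⟨b, hb⟩ := hV2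
  have hb' : b ∉ V1 := fun h ↦ (hpart b).mp h hb
  have h2 (v : V) : v ∈ V2 ↔ v ∉ V1 := by rw [hpart v, not_not]
  have hS (u v : V) (h : G.Adj u v) : u ∈ V1 ↔ v ∉ V1 := by
    have := hbip u v h
    rw [h2, h2] at this
    tauto
  constructor
  · rintro ⟨hG, δ1, δ2, hδ1, hδ2⟩
    exact hG.exists_aeval_adjMatrix_eq_of_biregular hS ha hb' hδ1
      fun u hu ↦ hδ2 u ((h2 u).mpr hu)
  · rintro ⟨P, hP⟩
    refine ⟨SimpleGraph.connected_of_aeval_adjMatrix_eq ha hb' hP, G.degree a, G.degree b,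
      fun u hu ↦ SimpleGraph.degree_eq_of_aeval_adjMatrix_eq hS hP (by tauto),
      fun u hu ↦ SimpleGraph.degree_eq_of_aeval_adjMatrix_eq hS hP ?_⟩
    have := (h2 u).mp hu
    tauto
end

section
/- Let Γ be a finite bipartite simple graph with nonempty parts V₁ (of size n₁) and V₂ (of size n₂), adjacency matrix A, and distinct adjacency eigenvalues θ₀ > θ₁ > ⋯ > θ_d. Suppose P is a real polynomial such that (P(A))_{uv} = 1 whenever u and v lie in different parts and (P(A))_{uv} = 0 whenever u and v lie in the same part. Then P(θ₀) = √(n₁·n₂), P(θ_d) = −√(n₁·n₂), and P(θ_i) = 0 for all i with 0 < i < d. -/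
open Finset Polynomial
open scoped Matrix

theorem Matrix.mem_spectrum_iff_exists_mulVec_eq_smul {V : Type*} [Fintype V] [DecidableEq V]
    (A : Matrix V V ℝ) (μ : ℝ) :
    μ ∈ spectrum ℝ A ↔ ∃ x : V → ℝ, x ≠ 0 ∧ A *ᵥ x = μ • x := by
  rw [← Matrix.spectrum_toLin', ← Module.End.hasEigenvalue_iff_mem_spectrum]
  constructor
  · intro h
    obtain ⟨x, hx⟩ := h.exists_hasEigenvector
    exact ⟨x, hx.2, by simpa using hx.apply_eq_smul⟩
  · rintro ⟨x, hx0, hx⟩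
    exact Module.End.hasEigenvalue_of_hasEigenvector (x := x)
      ⟨Module.End.mem_eigenspace_iff.2 (by simpa using hx), hx0⟩

theorem Matrix.aeval_mulVec_of_mulVec_eq_smul_s4 {V : Type*} [Fintype V] [DecidableEq V]
    {A : Matrix V V ℝ} {μ : ℝ} {x : V → ℝ} (h : A *ᵥ x = μ • x) (P : ℝ[X]) :
    (aeval A P) *ᵥ x = P.eval μ • x := by
  induction P using Polynomial.induction_on' with
  | add p q hp hq => simp [Matrix.add_mulVec, hp, hq, add_smul]
  | monomial n a =>
    have hpow : ∀ n : ℕ, (A ^ n) *ᵥ x = μ ^ n • x := by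
      intro n
      induction n with
      | zero => simp
      | succ n ih =>
        rw [pow_succ, ← Matrix.mulVec_mulVec, h, Matrix.mulVec_smul, ih, smul_smul, pow_succ,
          mul_comm]
    rw [aeval_monomial, Matrix.algebraMap_eq_diagonal, ← Matrix.mulVec_mulVec, hpow]
    ext v
    simp [Matrix.mulVec_diagonal, mul_assoc]

theorem Matrix.dotProduct_eq_zero_of_mulVec_eq_smul {V : Type*} [Fintype V]
    {A : Matrix V V ℝ} (hA : A.IsSymm) {μ ν : ℝ} {x y : V → ℝ}
    (hx : A *ᵥ x = μ • x) (hy : A *ᵥ y = ν • y) (hne : μ ≠ ν) : x ⬝ᵥ y = 0 := by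
  have h : x ⬝ᵥ (A *ᵥ y) = (A *ᵥ x) ⬝ᵥ y := by
    rw [Matrix.dotProduct_mulVec, ← Matrix.mulVec_transpose, hA.eq]
  rw [hx, hy, dotProduct_smul, smul_dotProduct, smul_eq_mul, smul_eq_mul] at h
  have : (μ - ν) * (x ⬝ᵥ y) = 0 := by linarith
  exact (mul_eq_zero.1 this).resolve_left (sub_ne_zero.2 hne)

/-- An eigenvalue of a nonnegative symmetric matrix is bounded in absolute value by the eigenvalue
of any positive eigenvector. -/
theorem Matrix.abs_le_of_pos_eigenvector {V : Type*} [Fintype V]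
    {A : Matrix V V ℝ} (hA : A.IsSymm) (hA0 : ∀ u v, 0 ≤ A u v) {l μ : ℝ} {w x : V → ℝ}
    (hw0 : ∀ v, 0 < w v) (hw : A *ᵥ w = l • w) (hx0 : x ≠ 0) (hx : A *ᵥ x = μ • x) :
    |μ| ≤ l := by
  have hle : ∀ u, |μ| * |x u| ≤ (A *ᵥ fun v => |x v|) u := by
    intro u
    have : μ * x u = ∑ v, A u v * x v := by
      simpa [Matrix.mulVec, dotProduct] using (congrFun hx u).symm
    rw [← abs_mul, this]
    refine (Finset.abs_sum_le_sum_abs _ _).trans (le_of_eq ?_)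
    simp [Matrix.mulVec, dotProduct, abs_mul, abs_of_nonneg (hA0 _ _)]
  have hsym : w ⬝ᵥ (A *ᵥ fun v => |x v|) = l * (w ⬝ᵥ fun v => |x v|) := by
    rw [Matrix.dotProduct_mulVec, ← Matrix.mulVec_transpose, hA.eq, hw, smul_dotProduct,
      smul_eq_mul]
  have hpos : 0 < w ⬝ᵥ fun v => |x v| := by
    obtain ⟨v, hv⟩ := Function.ne_iff.1 hx0
    exact Finset.sum_pos' (fun u _ => mul_nonneg (hw0 u).le (abs_nonneg _))
      ⟨v, Finset.mem_univ _, mul_pos (hw0 v) (abs_pos.2 hv)⟩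
  have hfin : |μ| * (w ⬝ᵥ fun v => |x v|) ≤ l * (w ⬝ᵥ fun v => |x v|) := by
    rw [← hsym, dotProduct, dotProduct, Finset.mul_sum]
    refine Finset.sum_le_sum fun u _ => ?_
    have := mul_le_mul_of_nonneg_left (hle u) (hw0 u).le
    linarith
  exact le_of_mul_le_mul_right hfin hpos

theorem crossOnes_mulVec {V : Type*} [Fintype V] [DecidableEq V] {V1 V2 : Finset V}
    (hpart : ∀ v, v ∈ V1 ↔ v ∉ V2) {M : Matrix V V ℝ}
    (hM : ∀ u v, M u v = if (u ∈ V1 ↔ v ∈ V1) then 0 else 1) (y : V → ℝ) (u : V) :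
    (M *ᵥ y) u = if u ∈ V1 then ∑ v ∈ V2, y v else ∑ v ∈ V1, y v := by
  simp only [Matrix.mulVec, dotProduct, hM]
  have h1 : V1 = Finset.univ.filter (· ∈ V1) := by ext; simp
  have h2 : V2 = Finset.univ.filter (· ∉ V1) := by ext; simp [hpart]
  split_ifs with hu
  · conv_rhs => rw [h2, Finset.sum_filter]
    refine Finset.sum_congr rfl fun v _ => ?_
    by_cases hv : v ∈ V1 <;> simp [hu, hv]
  · conv_rhs => rw [h1, Finset.sum_filter]
    refine Finset.sum_congr rfl fun v _ => ?_
    by_cases hv : v ∈ V1 <;> simp [hu, hv]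

/-- If a bipartite graph with parts `V1`, `V2` (sizes `n1`, `n2`) and
distinct eigenvalues `θ 0 > ⋯ > θ d` admits a polynomial `P` with `P(A)` having entries `1`
between the parts and `0` within the parts, then `P(θ 0) = √(n1·n2)`,
`P(θ d) = −√(n1·n2)` and `P(θ i) = 0` for `0 < i < d`. -/
theorem polynomial_values_of_crossOnesMatrix
    {V : Type*} [Fintype V] [DecidableEq V]
    (G : SimpleGraph V) [DecidableRel G.Adj]
    (V1 V2 : Finset V) (hV1 : V1.Nonempty) (hV2 : V2.Nonempty)
    (hpart : ∀ v, v ∈ V1 ↔ v ∉ V2)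
    (hbip : ∀ u v, G.Adj u v → ((u ∈ V1 ∧ v ∈ V2) ∨ (u ∈ V2 ∧ v ∈ V1)))
    (d : ℕ) (θ : Fin (d + 1) → ℝ) (hθ : StrictAnti θ)
    (hspec : spectrum ℝ (G.adjMatrix ℝ) = Set.range θ)
    (P : ℝ[X])
    (hP : ∀ u v : V,
      (Polynomial.aeval (G.adjMatrix ℝ) P) u v = if (u ∈ V1 ↔ v ∈ V1) then 0 else 1) :
    P.eval (θ 0) = Real.sqrt ((V1.card : ℝ) * (V2.card : ℝ)) ∧
    P.eval (θ (Fin.last d)) = -Real.sqrt ((V1.card : ℝ) * (V2.card : ℝ)) ∧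
    ∀ i : Fin (d + 1), i ≠ 0 → i ≠ Fin.last d → P.eval (θ i) = 0 := by
  set A := G.adjMatrix ℝ with hAdef
  set M := aeval A P with hMdef
  have hA : A.IsSymm := G.isSymm_adjMatrix
  have hA0 : ∀ u v, 0 ≤ A u v := fun u v => by
    rw [hAdef, SimpleGraph.adjMatrix_apply]; split_ifs <;> norm_num
  have hM := crossOnes_mulVec hpart hP
  have hV12 : ∀ v ∈ V2, v ∉ V1 := fun v hv h => (hpart v).1 h hv
  obtain ⟨v₁, hv₁⟩ := hV1
  obtain ⟨v₂, hv₂⟩ := hV2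
  have hn1 : (0 : ℝ) < V1.card := by exact_mod_cast Finset.card_pos.2 ⟨v₁, hv₁⟩
  have hn2 : (0 : ℝ) < V2.card := by exact_mod_cast Finset.card_pos.2 ⟨v₂, hv₂⟩
  rw [Real.sqrt_mul hn1.le]
  set a := √(V1.card : ℝ)
  set b := √(V2.card : ℝ)
  have ha : 0 < a := Real.sqrt_pos.2 hn1
  have hb : 0 < b := Real.sqrt_pos.2 hn2
  have haa : (V1.card : ℝ) = a * a := (Real.mul_self_sqrt hn1.le).symm
  have hbb : (V2.card : ℝ) = b * b := (Real.mul_self_sqrt hn2.le).symm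
  have sum1 : ∀ (f : V → ℝ) (c e : ℝ), (∀ v, f v = if v ∈ V1 then c else e) →
      ∑ v ∈ V1, f v = a * a * c := by
    intro f c e hf
    rw [Finset.sum_congr rfl fun v hv => (hf v).trans (if_pos hv)]
    simp [haa]
  have sum2 : ∀ (f : V → ℝ) (c e : ℝ), (∀ v, f v = if v ∈ V1 then c else e) →
      ∑ v ∈ V2, f v = b * b * e := by
    intro f c e hf
    rw [Finset.sum_congr rfl fun v hv => (hf v).trans (if_neg (hV12 v hv))]
    simp [hbb]
  let w : V → ℝ := fun v => if v ∈ V1 then b else a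
  let w' : V → ℝ := fun v => if v ∈ V1 then b else -a
  have hw0 : ∀ v, 0 < w v := fun v => by dsimp only [w]; split_ifs <;> assumption
  have hMw : M *ᵥ w = (a * b) • w := by
    ext u
    rw [hM, sum1 w b a fun _ => rfl, sum2 w b a fun _ => rfl, Pi.smul_apply, smul_eq_mul]
    dsimp only [w]
    split_ifs <;> ring
  have hMw' : M *ᵥ w' = (-(a * b)) • w' := by
    ext u
    rw [hM, sum1 w' b (-a) fun _ => rfl, sum2 w' b (-a) fun _ => rfl, Pi.smul_apply, smul_eq_mul]
    dsimp only [w']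
    split_ifs <;> ring
  have hcomm : M * A = A * M := by
    simpa using congrArg (aeval A) (mul_comm P X)
  obtain ⟨l, hl⟩ : ∃ l : ℝ, A *ᵥ w = l • w := by
    have h : M *ᵥ (A *ᵥ w) = (a * b) • (A *ᵥ w) := by
      rw [Matrix.mulVec_mulVec, hcomm, ← Matrix.mulVec_mulVec, hMw, Matrix.mulVec_smul]
    set y := A *ᵥ w
    have hy : ∀ v, y v = if v ∈ V1 then (∑ v ∈ V2, y v) / (a * b)
        else (∑ v ∈ V1, y v) / (a * b) := by
      intro v
      have := congrFun h v
      rw [hM, Pi.smul_apply, smul_eq_mul] at this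
      split_ifs at this ⊢ <;> rw [this] <;> field_simp
    have hs := sum1 y _ _ hy
    refine ⟨(∑ v ∈ V2, y v) / (a * b) / b, ?_⟩
    ext v
    rw [hy v, Pi.smul_apply, smul_eq_mul]
    dsimp only [w]
    split_ifs
    · field_simp
    · rw [hs]; field_simp
  have hl' : A *ᵥ w' = (-l) • w' := by
    ext u
    have hu := congrFun hl u
    have key : ∀ v, A u v * w' v = (if u ∈ V1 then -1 else 1) * (A u v * w v) := by
      intro v
      by_cases hadj : G.Adj u v
      · rcases hbip u v hadj with ⟨h1, h2⟩ | ⟨h1, h2⟩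
        · simp [w, w', h1, hV12 v h2]
        · simp [w, w', h2, hV12 u h1]
      · simp [hAdef, hadj]
    simp only [Matrix.mulVec, dotProduct, Pi.smul_apply, smul_eq_mul] at hu ⊢
    simp only [key, ← Finset.mul_sum, hu]
    dsimp only [w, w']
    split_ifs <;> ring
  have eval_of {x : V → ℝ} {μ c : ℝ} (hx0 : x ≠ 0) (hx : A *ᵥ x = μ • x)
      (hc : M *ᵥ x = c • x) : P.eval μ = c := by
    rw [hMdef, Matrix.aeval_mulVec_of_mulVec_eq_smul_s4 hx] at hc
    exact smul_left_injective ℝ hx0 hc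
  have hwne : w ≠ 0 := fun h => (hw0 v₁).ne' (congrFun h v₁)
  have hwne' : w' ≠ 0 := fun h => hb.ne' (by simpa [w', hv₁] using congrFun h v₁)
  have hPl := eval_of hwne hl hMw
  have hPl' := eval_of hwne' hl' hMw'
  have hspec' : ∀ μ, (∃ x : V → ℝ, x ≠ 0 ∧ A *ᵥ x = μ • x) ↔ ∃ i, θ i = μ := fun μ => by
    rw [← Matrix.mem_spectrum_iff_exists_mulVec_eq_smul, hspec, Set.mem_range]
  have hbound : ∀ i, |θ i| ≤ l := fun i => by
    obtain ⟨x, hx0, hx⟩ := (hspec' (θ i)).2 ⟨i, rfl⟩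
    exact Matrix.abs_le_of_pos_eigenvector hA hA0 hw0 hl hx0 hx
  have hθ0 : θ 0 = l := by
    obtain ⟨j, hj⟩ := (hspec' l).1 ⟨w, hwne, hl⟩
    exact le_antisymm ((le_abs_self _).trans (hbound 0)) (hj ▸ hθ.antitone (Fin.zero_le j))
  have hθd : θ (Fin.last d) = -l := by
    obtain ⟨j, hj⟩ := (hspec' (-l)).1 ⟨w', hwne', hl'⟩
    exact le_antisymm (hj ▸ hθ.antitone (Fin.le_last j)) (neg_le_of_abs_le (hbound _))
  refine ⟨hθ0 ▸ hPl, hθd ▸ hPl', fun i hi0 hid => ?_⟩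
  obtain ⟨x, hx0, hx⟩ := (hspec' (θ i)).2 ⟨i, rfl⟩
  have hdot : ∀ (y : V → ℝ) (c e : ℝ), (∀ v, y v = if v ∈ V1 then c else e) →
      y ⬝ᵥ x = c * ∑ v ∈ V1, x v + e * ∑ v ∈ V2, x v := by
    intro y c e hy
    have hcompl : V2 = V1ᶜ := by ext v; simp [hpart]
    rw [dotProduct, ← Finset.sum_add_sum_compl V1, ← hcompl, Finset.mul_sum, Finset.mul_sum]
    congr 1
    · exact Finset.sum_congr rfl fun v hv => by rw [hy, if_pos hv]
    · exact Finset.sum_congr rfl fun v hv => by rw [hy, if_neg (hV12 v hv)]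
  have h1 := Matrix.dotProduct_eq_zero_of_mulVec_eq_smul hA hl hx
    (hθ0 ▸ hθ.injective.ne hi0.symm)
  have h2 := Matrix.dotProduct_eq_zero_of_mulVec_eq_smul hA hl' hx
    (hθd ▸ hθ.injective.ne hid.symm)
  rw [hdot w b a fun _ => rfl] at h1
  rw [hdot w' b (-a) fun _ => rfl] at h2
  have hS1 : ∑ v ∈ V1, x v = 0 :=
    (mul_eq_zero.1 (by linarith : b * ∑ v ∈ V1, x v = 0)).resolve_left hb.ne'
  have hS2 : ∑ v ∈ V2, x v = 0 :=
    (mul_eq_zero.1 (by linarith : a * ∑ v ∈ V2, x v = 0)).resolve_left ha.ne'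
  refine eval_of hx0 hx ?_
  ext u
  simp [hM, hS1, hS2]
end

section
/- Let Γ be a connected δ-regular bipartite simple graph with d + 1 distinct adjacency eigenvalues θ₀ > θ₁ > ⋯ > θ_d and diameter D = d, with distance matrices A₀ = I, A₁ = A, A₂, …, A_d, and let E₁ be the principal idempotent associated with the second-largest eigenvalue θ₁. Then Γ is distance-regular if and only if E₁ lies in the real linear span of {A₀, A₁, A₂, …, A_d}. -/
open Finset Polynomial

/-- A connected graph with diameter `D` is distance-regular if for every `i ≤ D` there are
constants `c i`, `a i`, `b i` such that every vertex `v` at distance `i` from a vertex `u`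
has exactly `c i` neighbors at distance `i - 1` from `u`, exactly `a i` neighbors at
distance `i` from `u`, and exactly `b i` neighbors at distance `i + 1` from `u`. -/
def IsDistanceRegular {V : Type*} [Fintype V] [DecidableEq V]
    (G : SimpleGraph V) [DecidableRel G.Adj] (D : ℕ) : Prop :=
  ∀ i : ℕ, i ≤ D → ∃ c a b : ℕ, ∀ u v : V, G.dist u v = i →
    ((G.neighborFinset v).filter (fun w => G.dist u w + 1 = i)).card = c ∧
    ((G.neighborFinset v).filter (fun w => G.dist u w = i)).card = a ∧
    ((G.neighborFinset v).filter (fun w => G.dist u w = i + 1)).card = b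

section Spectral

variable {V : Type*} [Fintype V] [DecidableEq V]

lemma Matrix.IsHermitian.aeval_eq_conj_diagonal {A : Matrix V V ℝ} (hA : A.IsHermitian)
    (p : ℝ[X]) :
    aeval A p = (hA.eigenvectorUnitary : Matrix V V ℝ) *
      Matrix.diagonal (fun i => p.eval (hA.eigenvalues i)) *
      star (hA.eigenvectorUnitary : Matrix V V ℝ) := by
  conv_lhs => rw [hA.spectral_theorem]
  have h := Polynomial.aeval_algHom_apply
    (Unitary.conjStarAlgAut ℝ (Matrix V V ℝ) hA.eigenvectorUnitary).toAlgEquiv.toAlgHom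
    (Matrix.diagonal (RCLike.ofReal ∘ hA.eigenvalues : V → ℝ)) p
  have h2 := Polynomial.aeval_algHom_apply (Matrix.diagonalAlgHom (n := V) (α := ℝ) ℝ)
    (RCLike.ofReal ∘ hA.eigenvalues : V → ℝ) p
  have h3 : aeval (RCLike.ofReal ∘ hA.eigenvalues : V → ℝ) p
      = fun i => p.eval (hA.eigenvalues i) := by
    ext i
    simp
  rw [h3] at h2
  refine h.trans ?_
  refine (congrArg (Unitary.conjStarAlgAut ℝ (Matrix V V ℝ) hA.eigenvectorUnitary) h2).trans ?_
  exact Unitary.conjStarAlgAut_apply (S := ℝ) _ _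

lemma Matrix.IsHermitian.aeval_posSemidef {A : Matrix V V ℝ} (hA : A.IsHermitian)
    {p : ℝ[X]} (hp : ∀ x ∈ spectrum ℝ A, 0 ≤ p.eval x) : (aeval A p).PosSemidef := by
  rw [hA.aeval_eq_conj_diagonal]
  refine Matrix.PosSemidef.mul_mul_conjTranspose_same (Matrix.PosSemidef.diagonal ?_) _
  exact fun i => hp _ (hA.eigenvalues_mem_spectrum_real i)

lemma Matrix.IsHermitian.aeval_eq_zero {A : Matrix V V ℝ} (hA : A.IsHermitian)
    {p : ℝ[X]} (hp : ∀ x ∈ spectrum ℝ A, p.eval x = 0) : aeval A p = 0 := by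
  rw [hA.aeval_eq_conj_diagonal]
  have : (fun i => p.eval (hA.eigenvalues i)) = 0 :=
    funext fun i => hp _ (hA.eigenvalues_mem_spectrum_real i)
  simp [this]

lemma Matrix.exists_mulVec_eq_of_mem_spectrum {A : Matrix V V ℝ} {x : ℝ}
    (hx : x ∈ spectrum ℝ A) : ∃ z : V → ℝ, z ≠ 0 ∧ A.mulVec z = x • z := by
  rw [← Matrix.spectrum_toLin'] at hx
  obtain ⟨z, hz⟩ := (Module.End.HasEigenvalue.of_mem_spectrum hx).exists_hasEigenvector
  exact ⟨z, hz.2, by simpa using hz.apply_eq_smul⟩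

lemma Matrix.mem_spectrum_of_mulVec_eq {A : Matrix V V ℝ} {x : ℝ} {z : V → ℝ} (hz : z ≠ 0)
    (h : A.mulVec z = x • z) : x ∈ spectrum ℝ A := by
  rw [← Matrix.spectrum_toLin', ← Module.End.hasEigenvalue_iff_mem_spectrum]
  exact Module.End.hasEigenvalue_of_hasEigenvector
    (x := z) ⟨Module.End.mem_eigenspace_iff.2 (by simpa using h), hz⟩

lemma Matrix.aeval_mulVec_of_mulVec_eq {A : Matrix V V ℝ} {x : ℝ} {z : V → ℝ}
    (h : A.mulVec z = x • z) (p : ℝ[X]) : (aeval A p).mulVec z = p.eval x • z := by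
  induction p using Polynomial.induction_on' with
  | add p q hp hq => simp [Matrix.add_mulVec, hp, hq, add_smul]
  | monomial n a =>
    have : (A ^ n).mulVec z = x ^ n • z := by
      induction n with
      | zero => simp
      | succ n ih => rw [pow_succ, ← Matrix.mulVec_mulVec, h, Matrix.mulVec_smul, ih, smul_smul,
          pow_succ, mul_comm]
    rw [aeval_monomial, ← Matrix.mulVec_mulVec, this]
    simp [Matrix.algebraMap_eq_diagonal, Matrix.mulVec_smul]
    ext v; simp [Matrix.mulVec_diagonal]; ring

variable (G : SimpleGraph V) [DecidableRel G.Adj]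

lemma SimpleGraph.lapMatrix_mulVec_of_mulVec_eq {δ : ℕ} (hreg : G.IsRegularOfDegree δ) {x : ℝ}
    {z : V → ℝ} (h : (G.adjMatrix ℝ).mulVec z = x • z) :
    (G.lapMatrix ℝ).mulVec z = ((δ : ℝ) - x) • z := by
  ext v
  have h2 := congrFun h v
  rw [SimpleGraph.adjMatrix_mulVec_apply] at h2
  rw [SimpleGraph.lapMatrix_mulVec_apply, h2, hreg v]
  simp; ring

lemma SimpleGraph.le_degree_of_mem_spectrum {δ : ℕ} (hreg : G.IsRegularOfDegree δ) {x : ℝ}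
    (hx : x ∈ spectrum ℝ (G.adjMatrix ℝ)) : x ≤ δ := by
  obtain ⟨z, hz, h⟩ := Matrix.exists_mulVec_eq_of_mem_spectrum hx
  have h1 := (SimpleGraph.posSemidef_lapMatrix ℝ G).dotProduct_mulVec_nonneg z
  rw [G.lapMatrix_mulVec_of_mulVec_eq hreg h, dotProduct_smul, smul_eq_mul] at h1
  have : 0 < star z ⬝ᵥ z := Matrix.dotProduct_star_self_pos_iff.2 hz
  by_contra! hlt
  nlinarith

lemma SimpleGraph.degree_mem_spectrum [Nonempty V] {δ : ℕ} (hreg : G.IsRegularOfDegree δ) :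
    (δ : ℝ) ∈ spectrum ℝ (G.adjMatrix ℝ) := by
  refine Matrix.mem_spectrum_of_mulVec_eq (z := fun _ => 1) ?_ ?_
  · exact fun h => one_ne_zero (congrFun h (Classical.arbitrary V))
  · ext v
    simp [SimpleGraph.adjMatrix_mulVec_apply, hreg.degree_eq v]

/-- On the orthogonal complement of the constants, a vector whose Rayleigh quotient reaches the
second-largest eigenvalue of a connected regular graph is an eigenvector. -/
lemma SimpleGraph.adjMatrix_mulVec_eq_of_le_dotProduct (hconn : G.Connected) {δ : ℕ}
    (hreg : G.IsRegularOfDegree δ) {x : ℝ}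
    (hx : ∀ t ∈ spectrum ℝ (G.adjMatrix ℝ), t = δ ∨ t ≤ x)
    {y : V → ℝ} (hy : ∑ v, y v = 0)
    (hle : x * (y ⬝ᵥ y) ≤ y ⬝ᵥ (G.adjMatrix ℝ).mulVec y) :
    (G.adjMatrix ℝ).mulVec y = x • y := by
  have := hconn.nonempty
  have hA := G.isHermitian_adjMatrix ℝ
  set A := G.adjMatrix ℝ
  set S : Finset ℝ := (Matrix.finite_real_spectrum (A := A)).toFinset
  have hS : ∀ t, t ∈ S ↔ t ∈ spectrum ℝ A := fun t => Set.Finite.mem_toFinset _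
  set L := Lagrange.basis S id (δ : ℝ)
  have hL1 : L.eval (δ : ℝ) = 1 :=
    Lagrange.eval_basis_self (v := id) Function.injective_id.injOn
      ((hS _).2 (G.degree_mem_spectrum hreg))
  have hL0 : ∀ t ∈ spectrum ℝ A, t ≠ δ → L.eval t = 0 := fun t ht hne =>
    Lagrange.eval_basis_of_ne (v := id) hne.symm ((hS t).2 ht)
  have hL01 : ∀ t ∈ spectrum ℝ A, t ≠ δ ∧ L.eval t = 0 ∨ t = δ ∧ L.eval t = 1 := fun t ht => by
    by_cases h : t = δ
    · exact Or.inr ⟨h, h ▸ hL1⟩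
    · exact Or.inl ⟨h, hL0 t ht h⟩
  -- the projection onto the top eigenspace has constant rows, hence kills `y`
  have hpsd : (aeval A L).PosSemidef := hA.aeval_posSemidef fun t ht => by
    rcases hL01 t ht with h | h <;> simp [h.2]
  have hsymm : ∀ u v, aeval A L u v = aeval A L v u := fun u v => by
    simpa using (congrFun (congrFun hpsd.isHermitian u) v).symm
  have hmul : A * aeval A L = (δ : ℝ) • aeval A L := by
    have h0 : aeval A ((X - C (δ : ℝ)) * L) = 0 := hA.aeval_eq_zero fun t ht => by
      rcases hL01 t ht with h | h <;> simp [h.1, h.2]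
    rw [map_mul, map_sub, aeval_X, aeval_C, sub_mul, sub_eq_zero] at h0
    rw [h0, Algebra.smul_def]
  have hconst : ∀ u v w, aeval A L u v = aeval A L w v := fun u v w => by
    have h1 : A.mulVec (fun w => aeval A L w v) = (δ : ℝ) • fun w => aeval A L w v := by
      ext w
      exact congrFun (congrFun hmul w) v
    have h2 := G.lapMatrix_mulVec_of_mulVec_eq hreg h1
    rw [sub_self, zero_smul, G.lapMatrix_mulVec_eq_zero_iff_forall_reachable] at h2
    exact h2 u w (hconn u w)
  have hLy : (aeval A L).mulVec y = 0 := by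
    ext u
    have : ∀ v, aeval A L u v * y v = aeval A L u u * y v := fun v => by
      rw [hsymm u v, hconst v u u]
    simp only [Matrix.mulVec, dotProduct, this, ← Finset.mul_sum, hy, mul_zero, Pi.zero_apply]
  have hq : (aeval A ((C x - X) * (1 - L))).PosSemidef := hA.aeval_posSemidef fun t ht => by
    rcases hL01 t ht with h | h
    · simpa [h.2] using (hx t ht).resolve_left h.1
    · simp [h.2]
  have hqy : (aeval A ((C x - X) * (1 - L))).mulVec y = x • y - A.mulVec y := by
    rw [map_mul, ← Matrix.mulVec_mulVec, map_sub, map_sub, map_one, aeval_C, aeval_X,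
      Matrix.sub_mulVec, Matrix.sub_mulVec, hLy, Matrix.one_mulVec, sub_zero,
      Algebra.algebraMap_eq_smul_one, Matrix.smul_mulVec, Matrix.one_mulVec]
  have h0 := hq.dotProduct_mulVec_nonneg y
  have h1 := (hq.dotProduct_mulVec_zero_iff y).1
  rw [hqy] at h0 h1
  have h2 := h1 (le_antisymm (by
    rw [star_trivial, dotProduct_sub, dotProduct_smul, smul_eq_mul]; linarith) h0)
  exact (sub_eq_zero.1 h2).symm

end Spectral

/-- A sequence satisfying the three-term relations of the second-largest eigenvalue, which stays
nonpositive once it is nonpositive, has no two equal terms at distance two. -/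
lemma three_term_ne {δ x : ℝ} (hx : x < δ) {d : ℕ} {σ : ℕ → ℝ} (h0 : 0 < σ 0)
    (hsign : ∀ j k, j < k → k ≤ d → σ j ≤ 0 → σ k ≤ 0)
    (h : ∀ i ≤ d, ∃ c b : ℝ, c + b = δ ∧ 0 ≤ c ∧ 0 ≤ b ∧ (1 ≤ i → 1 ≤ c) ∧ (i = 0 → c = 0) ∧
      (i = d → b = 0) ∧ c * σ (i - 1) + b * σ (i + 1) = x * σ i)
    {i : ℕ} (hi : 1 ≤ i) (hid : i < d) : σ (i - 1) ≠ σ (i + 1) := by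
  intro heq
  have hδ : 1 ≤ δ := by
    obtain ⟨c, b, h1, h2, h3, h4, -⟩ := h i hid.le
    linarith [h4 hi]
  have hs : δ * σ (i + 1) = x * σ i := by
    obtain ⟨c, b, h1, h2, h3, h4, -, -, h5⟩ := h i hid.le
    rw [heq] at h5
    rw [← h5, ← h1]; ring
  rcases lt_trichotomy (σ i) 0 with hneg | hzero | hpos
  · -- from here on the sequence stays negative and increases, which fails at `d`
    have key : ∀ n, i + n < d ∧ σ (i + n) < 0 ∧ σ (i + n) < σ (i + n + 1) := by
      intro n
      induction n with
      | zero =>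
        refine ⟨hid, hneg, ?_⟩
        have : δ * σ i < δ * σ (i + 1) := by rw [hs]; nlinarith
        exact lt_of_mul_lt_mul_left this (by linarith)
      | succ n ih =>
        obtain ⟨ih1, ih2, ih3⟩ := ih
        rw [← add_assoc]
        set m := i + n
        obtain ⟨c, b, h1, h2, h3, h4, -, h6, h5⟩ := h (m + 1) (by omega)
        rw [Nat.add_sub_cancel] at h5
        have hc := h4 (by omega)
        have hle : σ (m + 1) ≤ 0 := hsign m _ (by omega) (by omega) ih2.le
        have hle2 : b * σ (m + 1 + 1) ≤ 0 := by
          rcases eq_or_lt_of_le (show m + 1 ≤ d by omega) with he | he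
          · simp [h6 he]
          · exact mul_nonpos_of_nonneg_of_nonpos h3 (hsign m _ (by omega) (by omega) ih2.le)
        have hlt : σ (m + 1) < 0 := by
          refine lt_of_le_of_ne hle fun he => ?_
          rw [he, mul_zero] at h5
          nlinarith
        have hgt : b * σ (m + 1) < b * σ (m + 1 + 1) := by
          have : c * σ m < c * σ (m + 1) := mul_lt_mul_of_pos_left ih3 (by linarith)
          have : δ * σ (m + 1) < x * σ (m + 1) := mul_lt_mul_of_neg_right hx hlt
          rw [← h1] at this
          linarith
        have hb : b ≠ 0 := by rintro rfl; simp at hgt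
        refine ⟨lt_of_le_of_ne (by omega) fun he => hb (h6 he), hlt, ?_⟩
        exact lt_of_mul_lt_mul_left hgt h3
    have := (key d).1
    omega
  · have hz : σ (i - 1) = 0 := by
      rw [heq]; rw [hzero, mul_zero] at hs
      exact (mul_eq_zero.1 hs).resolve_left (by linarith)
    have key : ∀ n, n < d → σ n = 0 → σ (n + 1) = 0 → False := by
      intro n
      induction n with
      | zero => intro _ h _; linarith
      | succ n ih =>
        intro hn h1 h2
        obtain ⟨c, b, -, -, -, h4, -, -, h5⟩ := h (n + 1) hn.le
        rw [h1, h2, Nat.add_sub_cancel, mul_zero, mul_zero, add_zero] at h5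
        have := h4 (by omega)
        exact ih (by omega) ((mul_eq_zero.1 h5).resolve_left (by linarith)) h1
    refine key (i - 1) (by omega) hz ?_
    rwa [Nat.sub_add_cancel hi]
  · have hall : ∀ m ≤ i, 0 < σ m := fun m hm => by
      by_contra! hle
      rcases eq_or_lt_of_le hm with rfl | hlt
      · linarith
      · linarith [hsign m i hlt hid.le hle]
    have key : ∀ n, n + 1 ≤ i → σ (n + 1) < σ n := by
      intro n
      induction n with
      | zero =>
        intro _
        obtain ⟨c, b, h1, h2, h3, h4, h6, -, h5⟩ := h 0 (by omega)
        rw [h6 rfl] at h5 h1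
        have : δ * σ (0 + 1) < δ * σ 0 := by rw [← h1]; nlinarith
        exact lt_of_mul_lt_mul_left this (by linarith)
      | succ n ih =>
        intro hn
        obtain ⟨c, b, h1, h2, h3, h4, -, -, h5⟩ := h (n + 1) (by omega)
        rw [Nat.add_sub_cancel] at h5
        have h7 := ih (by omega)
        have h8 : c * σ (n + 1) ≤ c * σ n := mul_le_mul_of_nonneg_left h7.le h2
        have h9 : x * σ (n + 1) < δ * σ (n + 1) :=
          mul_lt_mul_of_pos_right hx (hall _ (by omega))
        rw [← h1] at h9
        exact lt_of_mul_lt_mul_left (a := b) (by linarith) h3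
    have h1 := key (i - 1) (by omega)
    rw [Nat.sub_add_cancel hi, heq] at h1
    have : δ * σ i < δ * σ (i + 1) := mul_lt_mul_of_pos_left h1 (by linarith)
    nlinarith

section Layers

variable {V : Type*} [Fintype V] (G : SimpleGraph V) [DecidableRel G.Adj]

/-- The number of neighbors of `v` that are closer to `u` than `v` is. -/
noncomputable def SimpleGraph.numCloser (u v : V) : ℕ :=
  ((G.neighborFinset v).filter (fun w => G.dist u w + 1 = G.dist u v)).card

/-- The number of neighbors of `v` that are further from `u` than `v` is. -/
noncomputable def SimpleGraph.numFurther (u v : V) : ℕ :=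
  ((G.neighborFinset v).filter (fun w => G.dist u w = G.dist u v + 1)).card

variable {G}

omit [Fintype V] [DecidableRel G.Adj] in
lemma SimpleGraph.Connected.dist_ne_of_adj_of_bipartite (hconn : G.Connected)
    (hbip : ∃ f : V → Bool, ∀ u v : V, G.Adj u v → f u ≠ f v) {u v w : V} (h : G.Adj v w) :
    G.dist u v ≠ G.dist u w := by
  obtain ⟨f, hf⟩ := hbip
  let c : G.Coloring Bool := SimpleGraph.Coloring.mk f fun {a b} hab => hf a b hab
  obtain ⟨p, hp⟩ := hconn.exists_walk_length_eq_dist u v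
  obtain ⟨q, hq⟩ := hconn.exists_walk_length_eq_dist u w
  intro he
  have h1 := c.even_length_iff_congr p
  have h2 := c.even_length_iff_congr q
  rw [hp, he, ← hq, h2] at h1
  have := c.valid h
  revert this h1
  cases c u <;> cases c v <;> cases c w <;> simp

omit [Fintype V] [DecidableRel G.Adj] in
lemma SimpleGraph.Connected.dist_adj_cases (hconn : G.Connected)
    (hbip : ∃ f : V → Bool, ∀ u v : V, G.Adj u v → f u ≠ f v) {u v w : V} (h : G.Adj v w) :
    G.dist u w + 1 = G.dist u v ∨ G.dist u w = G.dist u v + 1 := by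
  have h1 := hconn.dist_ne_of_adj_of_bipartite hbip (u := u) h
  have h2 := h.diff_dist_adj (u := u)
  omega

omit [Fintype V] [DecidableRel G.Adj] in
lemma SimpleGraph.Connected.exists_adj_dist_add_one (hconn : G.Connected) {u v : V}
    (h : u ≠ v) : ∃ w, G.Adj v w ∧ G.dist u w + 1 = G.dist u v := by
  obtain ⟨p, hp⟩ := hconn.exists_walk_length_eq_dist v u
  cases p with
  | nil => exact absurd rfl h
  | cons hadj q =>
    rename_i w
    refine ⟨w, hadj, ?_⟩
    have h1 := G.dist_le q
    have h2 := hadj.diff_dist_adj (u := u)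
    rw [SimpleGraph.Walk.length_cons] at hp
    rw [G.dist_comm (u := v)] at hp
    rw [G.dist_comm (u := w)] at h1
    omega

omit [Fintype V] [DecidableRel G.Adj] in
lemma SimpleGraph.Connected.exists_dist_eq_of_le (hconn : G.Connected) {u v : V} {j : ℕ}
    (hj : j ≤ G.dist u v) : ∃ w, G.dist u w = j := by
  induction hn : G.dist u v generalizing v with
  | zero => exact ⟨v, by omega⟩
  | succ n ih =>
    rcases eq_or_lt_of_le hj with he | hlt
    · exact ⟨v, he.symm⟩
    · obtain ⟨w, -, hw⟩ := hconn.exists_adj_dist_add_one (u := u) (v := v) (by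
        rintro rfl; simp at hn)
      exact ih (v := w) (by omega) (by omega)

lemma SimpleGraph.Connected.one_le_numCloser (hconn : G.Connected) {u v : V}
    (h : 1 ≤ G.dist u v) : 1 ≤ G.numCloser u v := by
  obtain ⟨w, hw, hd⟩ := hconn.exists_adj_dist_add_one (u := u) (v := v) (by
    rintro rfl; simp at h)
  exact Finset.card_pos.2 ⟨w, by simp [hw, hd]⟩

lemma SimpleGraph.numCloser_eq_zero {u v : V} (h : G.dist u v = 0) : G.numCloser u v = 0 := by
  simp [SimpleGraph.numCloser, h]

lemma SimpleGraph.numFurther_eq_zero {u v : V} {d : ℕ} (hd : ∀ u v, G.dist u v ≤ d)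
    (h : G.dist u v = d) : G.numFurther u v = 0 := by
  refine Finset.card_eq_zero.2 (Finset.filter_eq_empty_iff.2 fun w _ hw => ?_)
  have := hd u w
  omega

lemma SimpleGraph.Connected.sum_neighborFinset_dist (hconn : G.Connected)
    (hbip : ∃ f : V → Bool, ∀ u v : V, G.Adj u v → f u ≠ f v) (g : ℕ → ℝ) (u v : V) :
    ∑ w ∈ G.neighborFinset v, g (G.dist u w) =
      G.numCloser u v * g (G.dist u v - 1) + G.numFurther u v * g (G.dist u v + 1) := by
  rw [← Finset.sum_filter_add_sum_filter_not _ (fun w => G.dist u w + 1 = G.dist u v)]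
  have hfilter : (G.neighborFinset v).filter (fun w => ¬ G.dist u w + 1 = G.dist u v) =
      (G.neighborFinset v).filter (fun w => G.dist u w = G.dist u v + 1) := by
    refine Finset.filter_congr fun w hw => ?_
    have := hconn.dist_adj_cases hbip (u := u) ((G.mem_neighborFinset v w).1 hw)
    omega
  rw [hfilter]
  congr 1
  · rw [Finset.sum_congr rfl (g := fun _ => g (G.dist u v - 1)), Finset.sum_const, nsmul_eq_mul]
    · rfl
    · intro w hw
      rw [← (Finset.mem_filter.1 hw).2, Nat.add_sub_cancel]
  · rw [Finset.sum_congr rfl (g := fun _ => g (G.dist u v + 1)), Finset.sum_const, nsmul_eq_mul]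
    · rfl
    · intro w hw
      rw [(Finset.mem_filter.1 hw).2]

lemma SimpleGraph.Connected.numCloser_add_numFurther (hconn : G.Connected) {δ : ℕ}
    (hreg : G.IsRegularOfDegree δ)
    (hbip : ∃ f : V → Bool, ∀ u v : V, G.Adj u v → f u ≠ f v) (u v : V) :
    G.numCloser u v + G.numFurther u v = δ := by
  have h := hconn.sum_neighborFinset_dist hbip (fun _ => 1) u v
  simp only [Finset.sum_const, nsmul_eq_mul, mul_one, G.card_neighborFinset_eq_degree,
    hreg.degree_eq v] at h
  exact_mod_cast h.symm

/-- Nodal domains: an eigenvector for the second-largest eigenvalue whose entries depend only on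
the distance to `u` stays nonpositive once it is nonpositive. -/
lemma SimpleGraph.Connected.nonpos_of_nonpos [DecidableEq V] (hconn : G.Connected) {δ : ℕ}
    (hreg : G.IsRegularOfDegree δ)
    (hbip : ∃ f : V → Bool, ∀ u v : V, G.Adj u v → f u ≠ f v) {x : ℝ}
    (hx : ∀ t ∈ spectrum ℝ (G.adjMatrix ℝ), t = δ ∨ t ≤ x)
    {σ : ℕ → ℝ} (h0 : 0 < σ 0)
    {u : V} (hσ : ∀ v, ∑ w ∈ G.neighborFinset v, σ (G.dist u w) = x * σ (G.dist u v))
    {j k : ℕ} (hjk : j < k) {v : V} (hv : G.dist u v = k) (hj : σ j ≤ 0) : σ k ≤ 0 := by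
  classical
  by_contra! hk
  have hex : ∃ j, σ j ≤ 0 := ⟨j, hj⟩
  obtain ⟨m, hm, hmin, hmj⟩ : ∃ m, σ m ≤ 0 ∧ (∀ i < m, 0 < σ i) ∧ m ≤ j :=
    ⟨Nat.find hex, Nat.find_spec hex, fun i hi => not_le.1 (Nat.find_min hex hi),
      Nat.find_min' hex hj⟩
  have hm0 : 1 ≤ m := by
    rcases Nat.eq_zero_or_pos m with rfl | h
    · linarith
    · exact h
  set p : ℕ → ℝ := fun i => if i < m then σ i else 0 with hp
  set q : ℕ → ℝ := fun i => if i < m then 0 else max (σ i) 0 with hq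
  have hp0 : ∀ i, 0 ≤ p i := fun i => by
    simp only [hp]; split_ifs with h
    · exact (hmin i h).le
    · exact le_rfl
  have hq0 : ∀ i, 0 ≤ q i := fun i => by
    simp only [hq]; split_ifs with h
    · exact le_rfl
    · exact le_max_right _ _
  set a : ℝ := ∑ w, q (G.dist u w) with ha
  set b : ℝ := ∑ w, p (G.dist u w) with hb
  have ha0 : 0 < a := Finset.sum_pos' (fun w _ => hq0 _) ⟨v, Finset.mem_univ _, by
    simp [hq, hv, show ¬ k < m by omega, hk]⟩
  have hb0 : 0 < b := Finset.sum_pos' (fun w _ => hp0 _) ⟨u, Finset.mem_univ _, by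
    simp [hp, show 0 < m by omega, h0]⟩
  set g : ℕ → ℝ := fun i => a * p i - b * q i with hg
  have hg_lt : ∀ i < m, g i = a * σ i := fun i hi => by simp [hg, hp, hq, hi]
  have hg_ge : ∀ i, m ≤ i → g i = - (b * max (σ i) 0) := fun i hi => by
    simp [hg, hp, hq, not_lt.2 hi]
  have hgm : g m = 0 := by rw [hg_ge m le_rfl, max_eq_right hm]; simp
  have hg1 : ∀ i ≤ m, a * σ i ≤ g i := fun i hi => by
    rcases eq_or_lt_of_le hi with rfl | hlt
    · rw [hgm]; nlinarith
    · rw [hg_lt i hlt]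
  have hg2 : ∀ i, m ≤ i → g i ≤ - (b * σ i) := fun i hi => by
    rw [hg_ge i hi]
    exact neg_le_neg (mul_le_mul_of_nonneg_left (le_max_left _ _) hb0.le)
  have hsum : ∑ w, g (G.dist u w) = 0 := by
    simp only [hg, Finset.sum_sub_distrib, ← Finset.mul_sum]
    rw [← ha, ← hb]; ring
  have hrec : ∀ w, (G.numCloser u w : ℝ) * σ (G.dist u w - 1) +
      G.numFurther u w * σ (G.dist u w + 1) = x * σ (G.dist u w) := fun w => by
    rw [← hσ, hconn.sum_neighborFinset_dist hbip]
  have hpt : ∀ w, x * (g (G.dist u w) * g (G.dist u w)) ≤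
      g (G.dist u w) * ∑ z ∈ G.neighborFinset w, g (G.dist u z) := fun w => by
    rw [hconn.sum_neighborFinset_dist hbip]
    have h1 := hrec w
    set i := G.dist u w
    have hc : (0 : ℝ) ≤ G.numCloser u w := Nat.cast_nonneg _
    have hf : (0 : ℝ) ≤ G.numFurther u w := Nat.cast_nonneg _
    rcases lt_or_ge i m with hlt | hge
    · have h2 := mul_le_mul_of_nonneg_left (hg1 (i - 1) (by omega)) hc
      have h3 := mul_le_mul_of_nonneg_left (hg1 (i + 1) (by omega)) hf
      have h4 : 0 ≤ g i := by rw [hg_lt i hlt]; exact mul_nonneg ha0.le (hmin i hlt).le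
      have h5 : x * g i ≤ G.numCloser u w * g (i - 1) + G.numFurther u w * g (i + 1) := by
        rw [hg_lt i hlt]; linear_combination h2 + h3 - a * h1
      nlinarith
    · rcases le_or_gt (σ i) 0 with hle | hpos
      · have : g i = 0 := by rw [hg_ge i hge, max_eq_right hle]; simp
        simp [this]
      · have hne : i ≠ m := by rintro h; rw [h] at hpos; linarith
        have h2 := mul_le_mul_of_nonneg_left (hg2 (i - 1) (by omega)) hc
        have h3 := mul_le_mul_of_nonneg_left (hg2 (i + 1) (by omega)) hf
        have h6 : g i = - (b * σ i) := by rw [hg_ge i hge, max_eq_left hpos.le]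
        have h4 : g i ≤ 0 := by rw [h6]; nlinarith
        have h5 : G.numCloser u w * g (i - 1) + G.numFurther u w * g (i + 1) ≤ x * g i := by
          rw [h6]; linear_combination h2 + h3 - b * h1
        nlinarith
  have heig := G.adjMatrix_mulVec_eq_of_le_dotProduct hconn hreg hx
    (y := fun w => g (G.dist u w)) hsum (by
      simp only [dotProduct, Finset.mul_sum, SimpleGraph.adjMatrix_mulVec_apply]
      refine Finset.sum_le_sum fun w _ => ?_
      rw [← Finset.mul_sum]
      exact hpt w)
  have hgrec : ∀ w, (G.numCloser u w : ℝ) * g (G.dist u w - 1) +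
      G.numFurther u w * g (G.dist u w + 1) = x * g (G.dist u w) := fun w => by
    have := congrFun heig w
    rw [SimpleGraph.adjMatrix_mulVec_apply, hconn.sum_neighborFinset_dist hbip] at this
    simpa using this
  obtain ⟨w, hw⟩ := hconn.exists_dist_eq_of_le (u := u) (v := v) (j := m) (by omega)
  obtain ⟨z, hadj, hz⟩ := hconn.exists_adj_dist_add_one (u := u) (v := w) (by
    rintro rfl; simp at hw; omega)
  have hz' : G.dist u z = m - 1 := by omega
  have hm1 : m - 1 + 1 = m := by omega
  have hσm : σ m = 0 := by
    have hf : (0 : ℝ) < G.numFurther u z :=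
      Nat.cast_pos.2 (Finset.card_pos.2 ⟨w, by simp [hadj.symm, hz', hw, hm1]⟩)
    have h1 := hrec z
    have h2 := hgrec z
    rw [hz', hm1] at h1 h2
    rw [hgm, hg_lt _ (by omega), hg_lt _ (by omega)] at h2
    have h3 : a * (G.numFurther u z * σ m) = 0 := by linear_combination a * h1 - h2
    simpa [ha0.ne', hf.ne'] using h3
  have hc : (1 : ℝ) ≤ G.numCloser u w := by
    exact_mod_cast hconn.one_le_numCloser (by omega)
  have h1 := hrec w
  have h2 := hgrec w
  rw [hw] at h1 h2
  rw [hgm, hg_lt _ (by omega), hg_ge _ (by omega)] at h2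
  rw [hσm] at h1
  have h3 := hmin (m - 1) (by omega)
  have hcp : 0 < (G.numCloser u w : ℝ) * σ (m - 1) := by positivity
  have hf : (0 : ℝ) ≤ G.numFurther u w := Nat.cast_nonneg _
  rcases le_or_gt (σ (m + 1)) 0 with hle | hpos
  · rw [max_eq_right hle] at h2
    have := mul_pos ha0 hcp
    linarith
  · nlinarith [mul_nonneg hf hpos.le]

end Layers

section DistanceSpan

variable {V : Type*} [Fintype V] {G : SimpleGraph V} [DecidableRel G.Adj]

omit [Fintype V] [DecidableRel G.Adj] in
lemma mem_span_distMatrix_iff {d : ℕ} (hle : ∀ u v, G.dist u v ≤ d) {M : Matrix V V ℝ} :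
    M ∈ Submodule.span ℝ (Set.range (fun i : Fin (d + 1) =>
      Matrix.of (fun u v : V => if G.dist u v = (i : ℕ) then (1 : ℝ) else 0))) ↔
    ∃ f : ℕ → ℝ, ∀ u v, M u v = f (G.dist u v) := by
  rw [Submodule.mem_span_range_iff_exists_fun]
  have hsum : ∀ (c : Fin (d + 1) → ℝ) (u v : V),
      (∑ i, c i • Matrix.of (fun u v : V => if G.dist u v = (i : ℕ) then (1 : ℝ) else 0)) u v =
      c ⟨G.dist u v, Nat.lt_succ_of_le (hle u v)⟩ := fun c u v => by
    rw [Matrix.sum_apply, Finset.sum_eq_single ⟨G.dist u v, Nat.lt_succ_of_le (hle u v)⟩]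
    · simp
    · intro i _ hi
      have : G.dist u v ≠ i := fun h => hi (Fin.ext h.symm)
      simp [this]
    · simp
  constructor
  · rintro ⟨c, rfl⟩
    refine ⟨fun n => if h : n < d + 1 then c ⟨n, h⟩ else 0, fun u v => ?_⟩
    rw [hsum]
    simp [Nat.lt_succ_of_le (hle u v)]
  · rintro ⟨f, hf⟩
    refine ⟨fun i => f i, ?_⟩
    ext u v
    rw [hsum, hf]

/-- Polynomials in the adjacency matrix of a distance-regular graph have entries that depend only
on the distance. -/
lemma IsDistanceRegular.exists_aeval_eq [DecidableEq V] {d : ℕ} (h : IsDistanceRegular G d)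
    (hconn : G.Connected) (hle : ∀ u v, G.dist u v ≤ d) (p : ℝ[X]) :
    ∃ f : ℕ → ℝ, ∀ u v, aeval (G.adjMatrix ℝ) p u v = f (G.dist u v) := by
  have hpow : ∀ n : ℕ, ∃ f : ℕ → ℝ, ∀ u v, (G.adjMatrix ℝ ^ n) u v = f (G.dist u v) := by
    intro n
    induction n with
    | zero =>
      refine ⟨fun i => if i = 0 then 1 else 0, fun u v => ?_⟩
      simp [Matrix.one_apply, hconn.dist_eq_zero_iff]
    | succ n ih =>
      obtain ⟨f, hf⟩ := ih
      choose c a b habc using h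
      refine ⟨fun i => if hi : i ≤ d then
        c i hi * f (i - 1) + a i hi * f i + b i hi * f (i + 1) else 0, fun u v => ?_⟩
      obtain ⟨h1, h2, h3⟩ := habc _ (hle u v) u v rfl
      rw [pow_succ, SimpleGraph.mul_adjMatrix_apply]
      beta_reduce
      rw [dif_pos (hle u v), ← h1, ← h2, ← h3]
      simp only [hf, Finset.card_filter, Nat.cast_sum, Finset.sum_mul, ← Finset.sum_add_distrib]
      refine Finset.sum_congr rfl fun w hw => ?_
      have hadj := ((G.mem_neighborFinset v w).1 hw).diff_dist_adj (u := u)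
      clear h1 h2 h3
      generalize G.dist u w = i at *
      generalize G.dist u v = j at *
      rcases (show i = j ∨ i = j + 1 ∨ i + 1 = j by omega) with rfl | rfl | rfl <;> simp
      · simp [show j + 1 + 1 ≠ j by omega]
      · simp [show i ≠ i + 1 + 1 by omega]
  induction p using Polynomial.induction_on' with
  | add p q hp hq =>
    obtain ⟨f, hf⟩ := hp
    obtain ⟨g, hg⟩ := hq
    exact ⟨f + g, fun u v => by simp [hf, hg]⟩
  | monomial n a =>
    obtain ⟨f, hf⟩ := hpow n
    exact ⟨a • f, fun u v => by
      rw [aeval_monomial, ← Algebra.smul_def, Matrix.smul_apply, hf, Pi.smul_apply]⟩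

lemma IsDistanceRegular.of_numCloser [DecidableEq V] (hconn : G.Connected) {δ : ℕ}
    (hreg : G.IsRegularOfDegree δ)
    (hbip : ∃ f : V → Bool, ∀ u v : V, G.Adj u v → f u ≠ f v) {d : ℕ}
    (h : ∀ u v u' v', G.dist u v = G.dist u' v' → G.numCloser u v = G.numCloser u' v') :
    IsDistanceRegular G d := by
  intro i _
  by_cases hex : ∃ u v, G.dist u v = i
  · obtain ⟨u, v, huv⟩ := hex
    refine ⟨G.numCloser u v, 0, G.numFurther u v, fun u' v' huv' => ⟨?_, ?_, ?_⟩⟩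
    · rw [h u v u' v' (huv.trans huv'.symm), ← huv']; rfl
    · refine Finset.card_eq_zero.2 (Finset.filter_eq_empty_iff.2 fun w hw => ?_)
      rw [← huv']
      exact (hconn.dist_ne_of_adj_of_bipartite hbip ((G.mem_neighborFinset v' w).1 hw)).symm
    · have h1 := hconn.numCloser_add_numFurther hreg hbip u v
      have h2 := hconn.numCloser_add_numFurther hreg hbip u' v'
      have h3 := h u v u' v' (huv.trans huv'.symm)
      have h4 : G.numFurther u' v' = G.numFurther u v := by omega
      rw [← h4, ← huv']; rfl
  · exact ⟨0, 0, 0, fun u v huv => absurd ⟨u, v, huv⟩ hex⟩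

end DistanceSpan

/-- A connected `δ`-regular bipartite graph with `d + 1` distinct
eigenvalues `θ 0 > ⋯ > θ d` and diameter `d` is distance-regular iff the principal
idempotent `E 1 = L 1 (A)` (Lagrange interpolation at the second-largest eigenvalue)
lies in the real span of the distance matrices `A_0, A_1, …, A_d`. -/
theorem bipartite_distRegular_iff_E1_in_distanceSpan
    {V : Type*} [Fintype V] [DecidableEq V]
    (G : SimpleGraph V) [DecidableRel G.Adj] (hconn : G.Connected)
    (δ : ℕ) (hreg : G.IsRegularOfDegree δ)
    (hbip : ∃ f : V → Bool, ∀ u v : V, G.Adj u v → f u ≠ f v)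
    (d : ℕ) (hd : 1 ≤ d)
    (θ : Fin (d + 1) → ℝ) (hθ : StrictAnti θ)
    (hspec : spectrum ℝ (G.adjMatrix ℝ) = Set.range θ)
    (hdiam : (∀ u v : V, G.dist u v ≤ d) ∧ ∃ u v : V, G.dist u v = d) :
    IsDistanceRegular G d ↔
      Polynomial.aeval (G.adjMatrix ℝ) (Lagrange.basis Finset.univ θ ⟨1, by omega⟩) ∈
        Submodule.span ℝ (Set.range (fun i : Fin (d + 1) =>
          Matrix.of (fun u v : V => if G.dist u v = (i : ℕ) then (1 : ℝ) else 0))) := by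
  obtain ⟨hle, u₀, v₀, huv₀⟩ := hdiam
  rw [mem_span_distMatrix_iff hle]
  have hA := G.isHermitian_adjMatrix ℝ
  have hθ0 : θ 0 = δ := by
    have := hconn.nonempty
    refine le_antisymm (G.le_degree_of_mem_spectrum hreg (hspec ▸ ⟨0, rfl⟩)) ?_
    obtain ⟨i, hi⟩ := hspec ▸ G.degree_mem_spectrum hreg
    exact hi ▸ hθ.antitone (Fin.zero_le i)
  set e : Fin (d + 1) := ⟨1, by omega⟩ with he
  set E := aeval (G.adjMatrix ℝ) (Lagrange.basis Finset.univ θ e) with hE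
  have hL : ∀ t ∈ spectrum ℝ (G.adjMatrix ℝ),
      t ≠ θ e ∧ (Lagrange.basis Finset.univ θ e).eval t = 0 ∨
      t = θ e ∧ (Lagrange.basis Finset.univ θ e).eval t = 1 := fun t ht => by
    obtain ⟨i, rfl⟩ := hspec ▸ ht
    by_cases hi : i = e
    · exact Or.inr ⟨congrArg θ hi, hi ▸
        Lagrange.eval_basis_self hθ.injective.injOn (Finset.mem_univ _)⟩
    · exact Or.inl ⟨hθ.injective.ne hi,
        Lagrange.eval_basis_of_ne (Ne.symm hi) (Finset.mem_univ _)⟩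
  constructor
  · exact fun h => h.exists_aeval_eq hconn hle _
  rintro ⟨σ, hσ⟩
  have hxδ : θ e < δ := hθ0 ▸ hθ (by simp [he, Fin.lt_def])
  have hx : ∀ t ∈ spectrum ℝ (G.adjMatrix ℝ), t = δ ∨ t ≤ θ e := fun t ht => by
    obtain ⟨i, rfl⟩ := hspec ▸ ht
    rcases eq_or_ne i 0 with rfl | hi
    · exact Or.inl hθ0
    · refine Or.inr (hθ.antitone ?_)
      rw [Fin.le_def]
      have := Fin.val_ne_zero_iff.2 hi
      simp only [he]; omega
  have hmul : E * G.adjMatrix ℝ = θ e • E := by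
    have h0 : aeval (G.adjMatrix ℝ) (Lagrange.basis Finset.univ θ e * (X - C (θ e))) = 0 :=
      hA.aeval_eq_zero fun t ht => by rcases hL t ht with h | h <;> simp [h.1, h.2]
    rw [map_mul, map_sub, aeval_X, aeval_C, mul_sub, sub_eq_zero] at h0
    rw [h0, ← Algebra.commutes, Algebra.smul_def]
  have hrec : ∀ u v, ∑ w ∈ G.neighborFinset v, σ (G.dist u w) = θ e * σ (G.dist u v) := by
    intro u v
    have := congrFun (congrFun hmul u) v
    rw [SimpleGraph.mul_adjMatrix_apply] at this
    simpa only [hσ, Matrix.smul_apply, smul_eq_mul] using this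
  have hpsd : E.PosSemidef := hA.aeval_posSemidef fun t ht => by
    rcases hL t ht with h | h <;> simp [h.2]
  have hσ0 : 0 < σ 0 := by
    by_contra! hneg
    have h1 : E.trace = 0 := le_antisymm
      (Finset.sum_nonpos fun u _ => by simpa [hσ] using hneg) hpsd.trace_nonneg
    have h2 : E = 0 := hpsd.trace_eq_zero_iff.1 h1
    obtain ⟨z, hz, hzA⟩ := Matrix.exists_mulVec_eq_of_mem_spectrum
      (A := G.adjMatrix ℝ) (x := θ e) (hspec ▸ ⟨e, rfl⟩)
    have h3 := Matrix.aeval_mulVec_of_mulVec_eq hzA (Lagrange.basis Finset.univ θ e)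
    rw [← hE, h2, Lagrange.eval_basis_self hθ.injective.injOn (Finset.mem_univ _), one_smul,
      Matrix.zero_mulVec] at h3
    exact hz h3.symm
  have hpair : ∀ i ≤ d, ∃ v, G.dist u₀ v = i := fun i hi =>
    hconn.exists_dist_eq_of_le (v := v₀) (huv₀ ▸ hi)
  have hlayer : ∀ u v, (G.numCloser u v : ℝ) * σ (G.dist u v - 1) +
      G.numFurther u v * σ (G.dist u v + 1) = θ e * σ (G.dist u v) := fun u v => by
    rw [← hconn.sum_neighborFinset_dist hbip, hrec]
  have hcf := hconn.numCloser_add_numFurther hreg hbip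
  have hne : ∀ i, 1 ≤ i → i < d → σ (i - 1) ≠ σ (i + 1) := fun i hi hid =>
    three_term_ne hxδ hσ0
      (fun j k hjk hk hj => by
        obtain ⟨v, hv⟩ := hpair k hk
        exact hconn.nonpos_of_nonpos hreg hbip hx hσ0 (hrec u₀) hjk hv hj)
      (fun i hi => by
        obtain ⟨v, rfl⟩ := hpair i hi
        refine ⟨G.numCloser u₀ v, G.numFurther u₀ v, by exact_mod_cast hcf u₀ v,
          Nat.cast_nonneg _, Nat.cast_nonneg _, fun h => ?_, fun h => ?_, fun h => ?_,
          hlayer u₀ v⟩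
        · exact_mod_cast hconn.one_le_numCloser h
        · exact_mod_cast SimpleGraph.numCloser_eq_zero h
        · exact_mod_cast SimpleGraph.numFurther_eq_zero hle h)
      hi hid
  refine IsDistanceRegular.of_numCloser hconn hreg hbip fun u v u' v' hd' => ?_
  have hcf1 := hcf u v
  have hcf2 := hcf u' v'
  rcases Nat.eq_zero_or_pos (G.dist u v) with h0 | hpos
  · rw [SimpleGraph.numCloser_eq_zero h0, SimpleGraph.numCloser_eq_zero (hd' ▸ h0)]
  rcases eq_or_lt_of_le (hle u v) with hmax | hlt
  · have h1 := SimpleGraph.numFurther_eq_zero hle hmax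
    have h2 := SimpleGraph.numFurther_eq_zero hle (hd' ▸ hmax)
    omega
  have h1 := hlayer u v
  have h2 := hlayer u' v'
  rw [← hd'] at h2
  have hc1 : (G.numCloser u v : ℝ) + G.numFurther u v = δ := by exact_mod_cast hcf1
  have hc2 : (G.numCloser u' v' : ℝ) + G.numFurther u' v' = δ := by exact_mod_cast hcf2
  have h3 : ((G.numCloser u v : ℝ) - G.numCloser u' v') *
      (σ (G.dist u v - 1) - σ (G.dist u v + 1)) = 0 := by
    linear_combination h1 - h2 - σ (G.dist u v + 1) * (hc1 - hc2)
  have h4 := (mul_eq_zero.1 h3).resolve_right (sub_ne_zero.2 (hne _ hpos hlt))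
  exact_mod_cast sub_eq_zero.1 h4
end

section
/- Let Γ be a connected δ-regular bipartite simple graph with d + 1 distinct adjacency eigenvalues and diameter D = d. Then Γ is distance-regular if and only if for every i with 0 ≤ i ≤ D − 2 there is a constant a_i^{(i)} such that (A^i)_{uv} = a_i^{(i)} for every pair of vertices u, v with dist(u,v) = i (i.e., the number of walks of length i between two vertices at distance i depends only on i). -/
open Finset Polynomial

namespace SimpleGraph

variable {V : Type*} [Fintype V] [DecidableEq V] {G : SimpleGraph V} [DecidableRel G.Adj]

lemma IsRegularOfDegree.lapMatrix_eq {δ : ℕ} (hreg : G.IsRegularOfDegree δ) :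
    G.lapMatrix ℝ = algebraMap ℝ (Matrix V V ℝ) δ - G.adjMatrix ℝ := by
  rw [lapMatrix, degMatrix, Matrix.algebraMap_eq_diagonal]
  congr 2
  ext v
  simp [hreg v]

/-- The degree of a nonempty regular graph is an adjacency eigenvalue. -/
lemma IsRegularOfDegree.mem_spectrum_adjMatrix [Nonempty V] {δ : ℕ}
    (hreg : G.IsRegularOfDegree δ) : (δ : ℝ) ∈ spectrum ℝ (G.adjMatrix ℝ) := by
  rw [spectrum.mem_iff, ← hreg.lapMatrix_eq]
  intro hunit
  obtain ⟨B, hB⟩ := hunit.exists_left_inv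
  have h : (fun _ : V ↦ (1 : ℝ)) = 0 := by
    rw [← Matrix.one_mulVec (fun _ : V ↦ (1 : ℝ)), ← hB, ← Matrix.mulVec_mulVec,
      lapMatrix_mulVec_const_eq_zero, Matrix.mulVec_zero]
  exact one_ne_zero (congrFun h (Classical.arbitrary V))

/-- A real polynomial vanishing on the adjacency spectrum annihilates the adjacency matrix. -/
lemma aeval_adjMatrix_eq_zero {p : ℝ[X]}
    (hp : ∀ x ∈ spectrum ℝ (G.adjMatrix ℝ), p.eval x = 0) : aeval (G.adjMatrix ℝ) p = 0 := by
  have hA : IsSelfAdjoint (G.adjMatrix ℝ) := G.isHermitian_adjMatrix ℝ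
  rw [← cfc_polynomial p (G.adjMatrix ℝ) hA, cfc_congr (g := fun _ ↦ 0) hp, cfc_const_zero]

/-- A matrix annihilated on both sides by the Laplacian of a connected graph is constant. -/
lemma Connected.apply_eq_of_lapMatrix_mul_eq_zero (hconn : G.Connected) {M : Matrix V V ℝ}
    (hl : G.lapMatrix ℝ * M = 0) (hr : M * G.lapMatrix ℝ = 0) (u v u' v' : V) :
    M u v = M u' v' := by
  have key : ∀ N : Matrix V V ℝ, G.lapMatrix ℝ * N = 0 → ∀ x y z, N x z = N y z := by
    intro N hN x y z
    have h : (G.lapMatrix ℝ).mulVec (fun w ↦ N w z) = 0 := by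
      ext w
      exact congrFun (congrFun hN w) z
    exact (lapMatrix_mulVec_eq_zero_iff_forall_reachable G).1 h x y (hconn x y)
  have hT : G.lapMatrix ℝ * M.transpose = 0 := by
    rw [← (G.isSymm_lapMatrix (R := ℝ)).eq, ← Matrix.transpose_mul, hr, Matrix.transpose_zero]
  exact (key M hl u u' v).trans (key M.transpose hT v v' u')

/-- Hoffman's polynomial: for a connected regular graph some polynomial of degree less than the
number of eigenvalues maps the adjacency matrix to a nonzero constant matrix. -/
lemma Connected.exists_aeval_adjMatrix_eq_const (hconn : G.Connected) {δ : ℕ}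
    (hreg : G.IsRegularOfDegree δ) {S : Finset ℝ} (hS : spectrum ℝ (G.adjMatrix ℝ) = S) :
    ∃ (p : ℝ[X]) (c : ℝ), p.natDegree < S.card ∧ c ≠ 0 ∧
      ∀ u v, aeval (G.adjMatrix ℝ) p u v = c := by
  have := hconn.nonempty
  have hδ : (δ : ℝ) ∈ S := by
    rw [← Finset.mem_coe, ← hS]
    exact hreg.mem_spectrum_adjMatrix
  let p : ℝ[X] := ∏ x ∈ S.erase δ, (X - C x)
  have hzero : aeval (G.adjMatrix ℝ) ((C (δ : ℝ) - X) * p) = 0 := by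
    refine aeval_adjMatrix_eq_zero fun x hx ↦ ?_
    rw [hS, Finset.mem_coe] at hx
    rw [eval_mul]
    by_cases h : x = δ
    · simp [h]
    · rw [eval_prod, Finset.prod_eq_zero (Finset.mem_erase.2 ⟨h, hx⟩) (by simp), mul_zero]
  have hl : G.lapMatrix ℝ * aeval (G.adjMatrix ℝ) p = 0 := by
    rw [hreg.lapMatrix_eq]
    simpa using hzero
  have hr : aeval (G.adjMatrix ℝ) p * G.lapMatrix ℝ = 0 := by
    rw [mul_comm] at hzero
    rw [hreg.lapMatrix_eq]
    simpa using hzero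
  have hconst := hconn.apply_eq_of_lapMatrix_mul_eq_zero hl hr
  let u₀ := Classical.arbitrary V
  refine ⟨p, aeval (G.adjMatrix ℝ) p u₀ u₀, ?_, fun h ↦ ?_, fun u v ↦ hconst u v u₀ u₀⟩
  · rw [natDegree_prod_of_monic _ _ fun x _ ↦ monic_X_sub_C x]
    simpa using Finset.card_erase_lt_of_mem hδ
  · have hp : aeval (G.adjMatrix ℝ) p = 0 := by
      ext u v
      rw [hconst u v u₀ u₀, h, Matrix.zero_apply]
    have hmem := spectrum.subset_polynomial_aeval (G.adjMatrix ℝ) p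
      ⟨δ, hreg.mem_spectrum_adjMatrix, rfl⟩
    rw [hp, spectrum.zero_eq, Set.mem_singleton_iff] at hmem
    simp only [p, eval_prod] at hmem
    rw [Finset.prod_eq_zero_iff] at hmem
    obtain ⟨x, hx, hx'⟩ := hmem
    rw [eval_sub, eval_X, eval_C, sub_eq_zero] at hx'
    exact Finset.ne_of_mem_erase hx hx'.symm

lemma adjMatrix_pow_apply_ne_zero_iff {n : ℕ} {u v : V} :
    (G.adjMatrix ℝ ^ n) u v ≠ 0 ↔ ∃ p : G.Walk u v, p.length = n := by
  rw [adjMatrix_pow_apply_eq_card_walk, Nat.cast_ne_zero, ← Nat.pos_iff_ne_zero, Fintype.card_pos_iff]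
  simp [nonempty_subtype]

lemma adjMatrix_pow_apply_eq_zero_of_lt_dist {n : ℕ} {u v : V} (h : n < G.dist u v) :
    (G.adjMatrix ℝ ^ n) u v = 0 := by
  by_contra hne
  obtain ⟨p, rfl⟩ := adjMatrix_pow_apply_ne_zero_iff.1 hne
  exact h.not_ge (dist_le p)

lemma Connected.adjMatrix_pow_dist_apply_ne_zero (hconn : G.Connected) (u v : V) :
    (G.adjMatrix ℝ ^ G.dist u v) u v ≠ 0 :=
  adjMatrix_pow_apply_ne_zero_iff.2 (hconn.exists_walk_length_eq_dist u v)

/-- In a connected bipartite graph, there are no walks whose length has the wrong parity. -/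
lemma Connected.adjMatrix_pow_dist_succ_apply_eq_zero (hconn : G.Connected)
    (f : G.Coloring Bool) (u v : V) : (G.adjMatrix ℝ ^ (G.dist u v + 1)) u v = 0 := by
  by_contra hne
  obtain ⟨p, hp⟩ := adjMatrix_pow_apply_ne_zero_iff.1 hne
  obtain ⟨q, hq⟩ := hconn.exists_walk_length_eq_dist u v
  have h := (f.even_length_iff_congr p).trans (f.even_length_iff_congr q).symm
  rw [hp, hq, Nat.even_add_one] at h
  tauto

lemma Connected.dist_ne_of_adj (hconn : G.Connected) (f : G.Coloring Bool) (u : V) {v w : V}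
    (h : G.Adj v w) : G.dist u v ≠ G.dist u w := by
  intro heq
  obtain ⟨p, hp⟩ := hconn.exists_walk_length_eq_dist u v
  refine (adjMatrix_pow_apply_ne_zero_iff (n := G.dist u w + 1)).2
    ⟨p.concat h, by rw [Walk.length_concat, hp, heq]⟩
    (hconn.adjMatrix_pow_dist_succ_apply_eq_zero f u w)

/-- Walks of length `i + 1` between vertices at distance `i + 1` extend walks of length `i`
between vertices at distance `i`. -/
lemma adjMatrix_pow_succ_apply_of_dist_eq {i : ℕ} {a : ℝ} {u v : V}
    (ha : ∀ w, G.dist u w = i → (G.adjMatrix ℝ ^ i) u w = a) (huv : G.dist u v = i + 1) :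
    (G.adjMatrix ℝ ^ (i + 1)) u v =
      ((G.neighborFinset v).filter (fun w ↦ G.dist u w + 1 = i + 1)).card * a := by
  rw [pow_succ, mul_adjMatrix_apply, ← nsmul_eq_mul, ← Finset.sum_const, Finset.sum_filter]
  refine Finset.sum_congr rfl fun w hw ↦ ?_
  rw [mem_neighborFinset] at hw
  split_ifs with h
  · exact ha w (by omega)
  · apply adjMatrix_pow_apply_eq_zero_of_lt_dist
    rcases hw.symm.diff_dist_adj (u := u) with h' | h' | h' <;> omega

end SimpleGraph

open SimpleGraph

section

variable {V : Type*} [Fintype V] [DecidableEq V] {G : SimpleGraph V} [DecidableRel G.Adj]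

lemma IsDistanceRegular.exists_adjMatrix_pow_apply_eq {D : ℕ} (hG : IsDistanceRegular G D)
    (hconn : G.Connected) {i : ℕ} (hi : i ≤ D) :
    ∃ a : ℝ, ∀ u v : V, G.dist u v = i → (G.adjMatrix ℝ ^ i) u v = a := by
  induction i with
  | zero =>
    refine ⟨1, fun u v huv ↦ ?_⟩
    rw [(hconn.dist_eq_zero_iff).1 huv, pow_zero, Matrix.one_apply_eq]
  | succ i ih =>
    obtain ⟨a, ha⟩ := ih (by omega)
    obtain ⟨c, _, _, h⟩ := hG (i + 1) hi
    refine ⟨c * a, fun u v huv ↦ ?_⟩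
    rw [adjMatrix_pow_succ_apply_of_dist_eq (fun w ↦ ha u w) huv, (h u v huv).1]

/-- A regular connected bipartite graph in which the numbers of shortest walks depend only on the
distance is distance-regular. -/
lemma isDistanceRegular_of_adjMatrix_pow_apply_eq {D δ : ℕ} (hconn : G.Connected)
    (hreg : G.IsRegularOfDegree δ) (f : G.Coloring Bool)
    (h : ∀ i ≤ D, ∃ a : ℝ, ∀ u v : V, G.dist u v = i → (G.adjMatrix ℝ ^ i) u v = a) :
    IsDistanceRegular G D := by
  intro i hi
  have hc : ∃ c : ℕ, ∀ u v : V, G.dist u v = i →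
      ((G.neighborFinset v).filter (fun w ↦ G.dist u w + 1 = i)).card = c := by
    rcases i with _ | i
    · exact ⟨0, by simp⟩
    obtain ⟨a, ha⟩ := h i (by omega)
    obtain ⟨b, hb⟩ := h (i + 1) hi
    refine ⟨⌊b / a⌋₊, fun u v huv ↦ ?_⟩
    have hab := adjMatrix_pow_succ_apply_of_dist_eq (fun w ↦ ha u w) huv
    have hb0 := hconn.adjMatrix_pow_dist_apply_ne_zero u v
    rw [huv, hab] at hb0
    rw [← hb u v huv, hab, mul_div_cancel_right₀ _ (right_ne_zero_of_mul hb0), Nat.floor_natCast]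
  obtain ⟨c, hc⟩ := hc
  refine ⟨c, 0, δ - c, fun u v huv ↦ ⟨hc u v huv, ?_, ?_⟩⟩
  · rw [Finset.card_eq_zero, Finset.filter_eq_empty_iff]
    intro w hw
    rw [mem_neighborFinset] at hw
    exact fun hi ↦ hconn.dist_ne_of_adj f u hw (huv.trans hi.symm)
  · have hcard := Finset.card_filter_add_card_filter_not (s := G.neighborFinset v)
      (fun w ↦ G.dist u w + 1 = i)
    rw [hc u v huv, card_neighborFinset_eq_degree, hreg v] at hcard
    rw [← hcard, Nat.add_sub_cancel_left]
    congr 1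
    refine Finset.filter_congr fun w hw ↦ ?_
    rw [mem_neighborFinset] at hw
    have hne := hconn.dist_ne_of_adj f u hw
    rcases hw.diff_dist_adj (u := u) with h' | h' | h' <;> omega

/-- In a connected regular bipartite graph with at most `d + 1` eigenvalues, the number of
shortest walks is constant at distances `d - 1` and `d`. -/
lemma exists_adjMatrix_pow_apply_eq_of_card_spectrum {d δ : ℕ} (hconn : G.Connected)
    (hreg : G.IsRegularOfDegree δ) (f : G.Coloring Bool) {S : Finset ℝ}
    (hS : spectrum ℝ (G.adjMatrix ℝ) = S) (hcard : S.card ≤ d + 1) {i : ℕ} (hi : d ≤ i + 1) :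
    ∃ a : ℝ, ∀ u v : V, G.dist u v = i → (G.adjMatrix ℝ ^ i) u v = a := by
  obtain ⟨p, c, hdeg, hc, hp⟩ := hconn.exists_aeval_adjMatrix_eq_const hreg hS
  refine ⟨c / p.coeff i, fun u v huv ↦ ?_⟩
  have hsum : p.coeff i * (G.adjMatrix ℝ ^ i) u v = c := by
    rw [← hp u v, aeval_eq_sum_range' (n := i + 2) (by omega), Matrix.sum_apply,
      Finset.sum_eq_single i]
    · simp
    · intro k hk hki
      rw [Finset.mem_range] at hk
      rw [Matrix.smul_apply, smul_eq_mul]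
      rcases lt_or_gt_of_ne hki with hlt | hgt
      · rw [adjMatrix_pow_apply_eq_zero_of_lt_dist (huv ▸ hlt), mul_zero]
      · obtain rfl : k = i + 1 := by omega
        rw [← huv, hconn.adjMatrix_pow_dist_succ_apply_eq_zero f, mul_zero]
    · simp
  rw [← hsum] at hc ⊢
  rw [mul_div_cancel_left₀ _ (left_ne_zero_of_mul hc)]

end

/-- A connected `δ`-regular bipartite graph with `d + 1` distinct
eigenvalues and diameter `D = d` is distance-regular iff, for every `i ≤ D - 2`, the
number of walks of length `i` between any two vertices at distance `i` is a constant
depending only on `i`. -/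
theorem bipartite_distRegular_iff_walkCounts
    {V : Type*} [Fintype V] [DecidableEq V]
    (G : SimpleGraph V) [DecidableRel G.Adj] (hconn : G.Connected)
    (δ : ℕ) (hreg : G.IsRegularOfDegree δ)
    (hbip : ∃ f : V → Bool, ∀ u v : V, G.Adj u v → f u ≠ f v)
    (d : ℕ)
    (θ : Fin (d + 1) → ℝ) (hθ : StrictAnti θ)
    (hspec : spectrum ℝ (G.adjMatrix ℝ) = Set.range θ)
    (hdiam : (∀ u v : V, G.dist u v ≤ d) ∧ ∃ u v : V, G.dist u v = d) :
    IsDistanceRegular G d ↔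
      ∀ i : ℕ, i ≤ d - 2 → ∃ a : ℝ, ∀ u v : V, G.dist u v = i →
        ((G.adjMatrix ℝ) ^ i) u v = a := by
  obtain ⟨f, hf⟩ := hbip
  let F : G.Coloring Bool := Coloring.mk f fun {u v} h ↦ hf u v h
  constructor
  · exact fun h i hi ↦ h.exists_adjMatrix_pow_apply_eq hconn (by omega)
  · refine fun h ↦ isDistanceRegular_of_adjMatrix_pow_apply_eq hconn hreg F fun i hi ↦ ?_
    by_cases hid : i ≤ d - 2
    · exact h i hid
    · refine exists_adjMatrix_pow_apply_eq_of_card_spectrum (d := d) hconn hreg F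
        (S := Finset.univ.image θ) (by simpa using hspec) ?_ (by omega)
      exact Finset.card_image_le.trans (by simp)
end

section
/- Let Γ be a connected bipartite simple graph with distinct adjacency eigenvalues θ₀ > θ₁ > ⋯ > θ_d and principal idempotents E₀, E₁, …, E_d. Then for all vertices u, v and all i with 0 ≤ i ≤ d, the crossed local multiplicities satisfy (E_i)_{uv} = (E_{d−i})_{uv} if dist(u,v) is even, and (E_i)_{uv} = −(E_{d−i})_{uv} if dist(u,v) is odd; equivalently, (E_i)_{uv} = (−1)^{dist(u,v)} (E_{d−i})_{uv}. -/
open Finset Polynomial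

theorem Polynomial.aeval_units_conj {R A : Type*} [CommSemiring R] [Semiring A] [Algebra R A]
    (u : Aˣ) (a : A) (p : R[X]) :
    aeval (↑u * a * ↑u⁻¹) p = ↑u * aeval a p * ↑u⁻¹ := by
  induction p using Polynomial.induction_on' with
  | add p q hp hq => simp only [map_add, hp, hq, mul_add, add_mul]
  | monomial n r =>
    simp only [aeval_monomial, Units.conj_pow, Algebra.algebraMap_eq_smul_one, smul_mul_assoc,
      mul_smul_comm, one_mul]

/-- If the nodes are antisymmetric under the order reversal, so are the Lagrange basis
polynomials. -/
theorem Lagrange.basis_rev_comp_neg {F : Type*} [Field F] {n : ℕ} (θ : Fin n → F)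
    (hθ : ∀ i, θ i.rev = -θ i) (i : Fin n) :
    (Lagrange.basis univ θ i.rev).comp (-X) = Lagrange.basis univ θ i := by
  unfold Lagrange.basis
  rw [Polynomial.prod_comp]
  refine prod_equiv Fin.revPerm (fun j => ?_) fun j _ => ?_
  · simp [Fin.rev_eq_iff]
  · have h : θ i.rev - θ j = -(θ i - θ (Fin.revPerm j)) := by
      rw [hθ, Fin.revPerm_apply, hθ]; ring
    unfold Lagrange.basisDivisor
    rw [h, inv_neg, Fin.revPerm_apply, hθ]
    simp only [mul_comp, sub_comp, C_comp, X_comp, neg_comp, map_neg]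
    ring

theorem StrictAnti.apply_rev_eq_neg {n : ℕ} {θ : Fin n → ℝ} (hθ : StrictAnti θ)
    (h : -Set.range θ = Set.range θ) (i : Fin n) : θ i.rev = -θ i := by
  have h₁ : StrictMono fun j : Fin n => θ j.rev := fun a b hab => hθ (Fin.rev_lt_rev.mpr hab)
  have h₂ : StrictMono fun j : Fin n => -θ j := fun a b hab => neg_lt_neg (hθ hab)
  have h₃ : (fun j : Fin n => θ j.rev) = fun j => -θ j := by
    refine (h₁.range_inj h₂).mp ?_
    have e₁ : Set.range (fun j : Fin n => θ j.rev) = Set.range θ :=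
      Fin.rev_surjective.range_comp θ
    have e₂ : Set.range (fun j : Fin n => -θ j) = -Set.range θ := by
      ext x
      simp [neg_eq_iff_eq_neg]
    rw [e₁, e₂, h]
  exact congrFun h₃ i

namespace SimpleGraph

variable {V : Type*} {G : SimpleGraph V}

/-- The sign `±1` attached to a vertex by a two-colouring. -/
def colorSign (f : V → Bool) (v : V) : ℝ := if f v then 1 else -1

theorem colorSign_mul_self (f : V → Bool) (v : V) : colorSign f v * colorSign f v = 1 := by
  unfold colorSign; split_ifs <;> norm_num

theorem colorSign_eq_neg {f : V → Bool} {u v : V} (h : f u ≠ f v) :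
    colorSign f u = -colorSign f v := by
  unfold colorSign
  cases hu : f u <;> cases hv : f v <;> simp_all

theorem Walk.colorSign_mul_colorSign {f : V → Bool} (hf : ∀ u v, G.Adj u v → f u ≠ f v)
    {u v : V} (p : G.Walk u v) : colorSign f u * colorSign f v = (-1) ^ p.length := by
  induction p with
  | nil => simp [colorSign_mul_self]
  | cons h p ih => rw [colorSign_eq_neg (hf _ _ h), Walk.length_cons, pow_succ, ← ih]; ring

/-- The diagonal matrix of the signs of a two-colouring, as a unit. -/
def colorSignUnit [Fintype V] [DecidableEq V] (f : V → Bool) : (Matrix V V ℝ)ˣ where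
  val := Matrix.diagonal (colorSign f)
  inv := Matrix.diagonal (colorSign f)
  val_inv := by simp [Matrix.diagonal_mul_diagonal, colorSign_mul_self]
  inv_val := by simp [Matrix.diagonal_mul_diagonal, colorSign_mul_self]

theorem colorSignUnit_conj_apply [Fintype V] [DecidableEq V] (f : V → Bool) (M : Matrix V V ℝ)
    (u v : V) :
    ((colorSignUnit f : Matrix V V ℝ) * M * ((colorSignUnit f)⁻¹ : (Matrix V V ℝ)ˣ)) u v =
      colorSign f u * colorSign f v * M u v := by
  change (Matrix.diagonal (colorSign f) * M * Matrix.diagonal (colorSign f)) u v = _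
  rw [Matrix.mul_diagonal, Matrix.diagonal_mul]
  ring

theorem colorSignUnit_conj_adjMatrix [Fintype V] [DecidableEq V] [DecidableRel G.Adj]
    {f : V → Bool} (hf : ∀ u v, G.Adj u v → f u ≠ f v) :
    (colorSignUnit f : Matrix V V ℝ) * G.adjMatrix ℝ * ((colorSignUnit f)⁻¹ : (Matrix V V ℝ)ˣ) =
      -G.adjMatrix ℝ := by
  ext u v
  rw [colorSignUnit_conj_apply, Matrix.neg_apply, adjMatrix_apply]
  split_ifs with h
  · rw [colorSign_eq_neg (hf u v h), neg_mul, colorSign_mul_self, neg_mul, one_mul]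
  · simp

end SimpleGraph

/-- In a connected bipartite graph with distinct eigenvalues
`θ 0 > θ 1 > ⋯ > θ d` and principal idempotents `E i = L i (A)` (Lagrange interpolation),
the crossed local multiplicities satisfy
`(E i)_{uv} = (−1)^{dist(u,v)} (E (d−i))_{uv}` for all vertices `u, v` and all `i`. -/
theorem bipartite_crossedLocalMultiplicities_symmetry
    {V : Type*} [Fintype V] [DecidableEq V]
    (G : SimpleGraph V) [DecidableRel G.Adj] (hconn : G.Connected)
    (hbip : ∃ f : V → Bool, ∀ u v : V, G.Adj u v → f u ≠ f v)
    (d : ℕ) (θ : Fin (d + 1) → ℝ) (hθ : StrictAnti θ)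
    (hspec : spectrum ℝ (G.adjMatrix ℝ) = Set.range θ) :
    ∀ (i : Fin (d + 1)) (u v : V),
      (Polynomial.aeval (G.adjMatrix ℝ) (Lagrange.basis Finset.univ θ i)) u v =
        (-1 : ℝ) ^ (G.dist u v) *
          (Polynomial.aeval (G.adjMatrix ℝ) (Lagrange.basis Finset.univ θ i.rev)) u v := by
  obtain ⟨f, hf⟩ := hbip
  intro i u v
  have hconj := SimpleGraph.colorSignUnit_conj_adjMatrix (G := G) hf
  have hsymm : -Set.range θ = Set.range θ := by
    rw [← hspec, spectrum.neg_eq, ← hconj, spectrum.units_conjugate]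
  obtain ⟨p, hp⟩ := hconn.exists_walk_length_eq_dist u v
  rw [← hp, ← p.colorSign_mul_colorSign hf, ← SimpleGraph.colorSignUnit_conj_apply,
    ← Polynomial.aeval_units_conj, hconj,
    ← Lagrange.basis_rev_comp_neg θ (hθ.apply_rev_eq_neg hsymm) i, aeval_comp]
  simp
end
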